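/- arXiv:2602.18864 — 3 statements merged into one kernel-verified Lean document; each statement's English description precedes it below -/
import Mathlib

section
/- There exists a 2-regular 2-D (m×n,3,1)-OOC with Υ(m,0,n,2,3) = m²(n−2)/6 codewords in each of the following two cases: (1) m ≡ 3 (mod 6), n ≡ 0 or 2 (mod 8) and n ≥ 8; (2) m ≡ 6 (mod 12), n ≡ 2 (mod 4) and n ≥ 6. -/
/-- The cyclic shift of a codeword `B ⊆ I_m × Z_n` by `τ`. -/
def OOCshift {m n : ℕ} (B : Finset (Fin m × ZMod n)) (τ : ZMod n) :
    Finset (Fin m × ZMod n) :=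
  B.image fun p => (p.1, p.2 + τ)

/-- A two-dimensional `(m × n, k, lam)` optical orthogonal code: a family of
`k`-element codewords of `I_m × Z_n` with auto- and cross-correlation at most `lam`. -/
def IsOOC (m n k lam : ℕ) (C : Finset (Finset (Fin m × ZMod n))) : Prop :=
  (∀ A ∈ C, A.card = k) ∧
  (∀ A ∈ C, ∀ τ : ZMod n, τ ≠ 0 → (A ∩ OOCshift A τ).card ≤ lam) ∧
  (∀ A ∈ C, ∀ B ∈ C, A ≠ B → ∀ τ : ZMod n, (A ∩ OOCshift B τ).card ≤ lam)

/-- The multiset `Δ_{ij}(C)` of all (pure and mixed) `(i,j)`-differences of the family `C`. -/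
def Delta {m n : ℕ} (i j : Fin m) (C : Finset (Finset (Fin m × ZMod n))) :
    Multiset (ZMod n) :=
  ∑ B ∈ C, (((B ×ˢ B).filter fun p => p.1 ≠ p.2 ∧ p.1.1 = i ∧ p.2.1 = j).val.map
      fun p => p.1.2 - p.2.2)

/-- A `g`-regular 2-D `([m : r] × n, k, 1)`-OOC with hole `R × Z_n` (`r = R.card`):
for `{i,j} ⊄ R` the multiset `Δ_{ij}(C)` is exactly `Z_n \ H` (each element once), where
`H = {z : g • z = 0}` is the subgroup of order `g` of `Z_n`, and `Δ_{ij}(C) = ∅` otherwise. -/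
def IsGRegOOC {m n : ℕ} (k g : ℕ) (R : Finset (Fin m))
    (C : Finset (Finset (Fin m × ZMod n))) : Prop :=
  (∀ A ∈ C, A.card = k) ∧
  ∀ i j : Fin m, ∀ z : ZMod n,
    Multiset.count z (Delta i j C) =
      if i ∈ R ∧ j ∈ R then 0 else if g • z = 0 then 0 else 1

/-- Number of non-2-torsion elements. -/
lemma card_nontors (u : ℕ) (hu : 0 < u) [NeZero (2 * u)] :
    (Finset.univ.filter fun z : ZMod (2 * u) => 2 • z ≠ 0).card = 2 * u - 2 := by
  have h1 : (Finset.univ.filter fun z : ZMod (2 * u) => 2 • z ≠ 0)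
      = Finset.univ \ ({0, (u : ZMod (2 * u))} : Finset (ZMod (2 * u))) := by
    ext z
    simp only [Finset.mem_filter, Finset.mem_univ, true_and, Finset.mem_sdiff, Finset.mem_insert,
      Finset.mem_singleton]
    rw [not_iff_not]
    have hv := ZMod.val_lt z
    have hz : ((z.val : ℕ) : ZMod (2 * u)) = z := ZMod.natCast_zmod_val z
    constructor
    · intro h
      have h2 : ((2 * z.val : ℕ) : ZMod (2 * u)) = 0 := by
        push_cast; rw [hz]; simpa [two_mul, two_smul] using h
      rw [ZMod.natCast_eq_zero_iff] at h2
      have h3 : u ∣ z.val := Nat.dvd_of_mul_dvd_mul_left (by norm_num) h2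
      obtain ⟨c, hc⟩ := h3
      have : c < 2 := by
        by_contra hcc
        have : u * 2 ≤ u * c := Nat.mul_le_mul_left _ (by omega)
        omega
      interval_cases c
      · left; rw [← hz, hc]; simp
      · right; rw [← hz, hc]; simp
    · rintro (h | h)
      · simp [h]
      · rw [h]
        have : ((2 * u : ℕ) : ZMod (2 * u)) = 0 := ZMod.natCast_self _
        rw [two_smul]; push_cast at this; rw [← this]; ring
  rw [h1, Finset.card_sdiff_of_subset (Finset.subset_univ _), Finset.card_univ, ZMod.card,
    Finset.card_pair]
  intro h
  have := (ZMod.natCast_eq_zero_iff u (2 * u)).1 h.symm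
  exact absurd (Nat.le_of_dvd hu this) (by omega)

lemma main_lemma (m u : ℕ) (hu : 0 < u) {K R : Type} [Fintype K] [Fintype R]
    (hR : Fintype.card R = m) (f : K → Fin 3 → R × ZMod (2 * u))
    (hK : Fintype.card K * 6 = m ^ 2 * (2 * u - 2))
    (hsurj : ∀ i j z, 2 • z ≠ 0 → ∃ κ s s', s ≠ s' ∧ (f κ s).1 = i ∧ (f κ s').1 = j ∧
      (f κ s).2 - (f κ s').2 = z) :
    ∃ C : Finset (Finset (Fin m × ZMod (2 * u))),
      IsGRegOOC 3 2 (∅ : Finset (Fin m)) C ∧ C.card = m ^ 2 * (2 * u - 2) / 6 := by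
  classical
  have : NeZero (2 * u) := ⟨by omega⟩
  have e : R ≃ Fin m := Fintype.equivFinOfCardEq hR
  let P := {x : Fin 3 × Fin 3 // x.1 ≠ x.2}
  have hP : Fintype.card P = 6 := by decide
  let g : K → Fin 3 → Fin m × ZMod (2 * u) := fun κ s => (e (f κ s).1, (f κ s).2)
  let Φ : K × P → (Fin m × Fin m) × ZMod (2 * u) := fun x =>
    (((g x.1 x.2.1.1).1, (g x.1 x.2.1.2).1), (g x.1 x.2.1.1).2 - (g x.1 x.2.1.2).2)
  let T : Finset ((Fin m × Fin m) × ZMod (2 * u)) :=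
    Finset.univ ×ˢ (Finset.univ.filter fun z : ZMod (2 * u) => 2 • z ≠ 0)
  have hT : T.card = m ^ 2 * (2 * u - 2) := by
    rw [Finset.card_product, card_nontors u hu]
    simp [sq]
  have hsub : T ⊆ Finset.univ.image Φ := by
    rintro ⟨⟨i, j⟩, z⟩ hx
    have hz : 2 • z ≠ 0 := by simpa [T] using hx
    obtain ⟨κ, s, s', hs, h1, h2, h3⟩ := hsurj (e.symm i) (e.symm j) z hz
    refine Finset.mem_image.2 ⟨(κ, ⟨(s, s'), hs⟩), Finset.mem_univ _, ?_⟩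
    simp [Φ, g, h1, h2, h3]
  have hdom : (Finset.univ : Finset (K × P)).card = T.card := by
    rw [Finset.card_univ, Fintype.card_prod, hP, hK, hT]
  have heq : T = Finset.univ.image Φ :=
    Finset.eq_of_subset_of_card_le hsub (Finset.card_image_le.trans hdom.le)
  have hinj : Function.Injective Φ := by
    have := Finset.card_image_iff.1 ((congrArg Finset.card heq).symm.trans hdom.symm)
    intro a b hab
    exact this (by simp) (by simp) hab
  have hmemT : ∀ x, 2 • (Φ x).2 ≠ 0 := by
    intro x
    have : Φ x ∈ T := by rw [heq]; exact Finset.mem_image_of_mem _ (Finset.mem_univ _)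
    simpa [T] using this
  have hginj : ∀ κ, Function.Injective (g κ) := by
    intro κ s s' h
    by_contra hs
    apply hmemT (κ, ⟨(s, s'), hs⟩)
    simp [Φ, h]
  let B : K → Finset (Fin m × ZMod (2 * u)) := fun κ => Finset.univ.image (g κ)
  have hBcard : ∀ κ, (B κ).card = 3 := by
    intro κ
    rw [Finset.card_image_of_injective _ (hginj κ)]; simp
  have hBinj : Function.Injective B := by
    intro κ κ' h
    have h0 : g κ 0 ∈ B κ' := by rw [← h]; exact Finset.mem_image_of_mem _ (Finset.mem_univ _)
    have h1 : g κ 1 ∈ B κ' := by rw [← h]; exact Finset.mem_image_of_mem _ (Finset.mem_univ _)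
    obtain ⟨s, -, hs⟩ := Finset.mem_image.1 h0
    obtain ⟨s', -, hs'⟩ := Finset.mem_image.1 h1
    have hne : s ≠ s' := by
      rintro rfl
      have := hginj κ (hs.symm.trans hs')
      exact absurd this (by decide)
    have := @hinj (κ', ⟨(s, s'), hne⟩) (κ, ⟨(0, 1), by decide⟩) (by simp [Φ, hs, hs'])
    exact (Prod.ext_iff.1 this).1.symm
  refine ⟨Finset.univ.image B, ⟨?_, ?_⟩, ?_⟩
  · intro A hA
    obtain ⟨κ, -, rfl⟩ := Finset.mem_image.1 hA
    exact hBcard κ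
  · intro i j z
    have hone : ∀ κ, Multiset.count z
        ((((B κ) ×ˢ (B κ)).filter fun p => p.1 ≠ p.2 ∧ p.1.1 = i ∧ p.2.1 = j).val.map
          fun p => p.1.2 - p.2.2)
        = (Finset.univ.filter fun x : P => Φ (κ, x) = ((i, j), z)).card := by
      intro κ
      rw [Multiset.count_map, ← Finset.filter_val, Finset.card_val]
      symm
      apply Finset.card_bij (fun x _ => (g κ x.1.1, g κ x.1.2))
      · intro x hx
        simp only [Finset.mem_filter, Finset.mem_univ, true_and, Φ, Prod.mk.injEq] at hx
        simp only [Finset.mem_filter, Finset.mem_product]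
        refine ⟨⟨⟨?_, ?_⟩, ?_, hx.1.1, hx.1.2⟩, hx.2.symm⟩
        · exact Finset.mem_image_of_mem _ (Finset.mem_univ _)
        · exact Finset.mem_image_of_mem _ (Finset.mem_univ _)
        · exact fun h => x.2 (hginj κ h)
      · intro x _ y _ h
        simp only [Prod.mk.injEq] at h
        exact Subtype.ext (Prod.ext (hginj κ h.1) (hginj κ h.2))
      · rintro ⟨p, q⟩ h
        simp only [Finset.mem_filter, Finset.mem_product] at h
        obtain ⟨⟨⟨hp, hq⟩, hne, h1, h2⟩, h3⟩ := h
        obtain ⟨s, -, rfl⟩ := Finset.mem_image.1 hp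
        obtain ⟨s', -, rfl⟩ := Finset.mem_image.1 hq
        refine ⟨⟨(s, s'), fun h => hne (by rw [show s = s' from h])⟩, ?_, rfl⟩
        simp [Φ, h1, h2, h3]
    have hcount : Multiset.count z (Delta i j (Finset.univ.image B))
        = (Finset.univ.filter fun x : K × P => Φ x = ((i, j), z)).card := by
      unfold Delta
      rw [Multiset.count_sum', Finset.sum_image (fun a _ b _ h => hBinj h)]
      rw [Finset.sum_congr rfl (fun κ _ => hone κ)]
      simp only [Finset.card_filter]
      rw [Fintype.sum_prod_type]
    rw [hcount]
    simp only [Finset.notMem_empty, false_and, if_false]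
    split_ifs with hz
    · rw [Finset.card_eq_zero, Finset.filter_eq_empty_iff]
      intro x _ hx
      apply hmemT x
      rw [hx]; exact hz
    · have : ((i, j), z) ∈ Finset.univ.image Φ := by
        rw [← heq]; simpa [T] using hz
      obtain ⟨x, -, hx⟩ := Finset.mem_image.1 this
      rw [Finset.card_eq_one]
      refine ⟨x, ?_⟩
      ext y
      simp only [Finset.mem_filter, Finset.mem_univ, true_and, Finset.mem_singleton]
      constructor
      · intro hy; exact hinj (hy.trans hx.symm)
      · rintro rfl; exact hx
  · rw [Finset.card_image_of_injective _ hBinj, Finset.card_univ, ← hK]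
    simp

/-- Case 1 from a starter. -/
lemma case_one (t u : ℕ) (ht : 0 < t) (hu : 0 < u) (p q : Fin (u - 1) → ZMod (2 * u))
    (hd : ∀ z : ZMod (2 * u), 2 • z ≠ 0 → ∃ k, z = p k - q k ∨ z = q k - p k)
    (hc : ∀ z : ZMod (2 * u), 2 • z ≠ 0 → ∃ k, z = p k ∨ z = q k) :
    ∃ C : Finset (Finset (Fin (3 * t) × ZMod (2 * u))),
      IsGRegOOC 3 2 (∅ : Finset (Fin (3 * t))) C ∧ C.card = (3 * t) ^ 2 * (2 * u - 2) / 6 := by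
  have : NeZero t := ⟨ht.ne'⟩
  apply main_lemma (3 * t) u hu (K := ZMod 3 × ZMod t × ZMod t × Fin (u - 1))
    (R := ZMod 3 × ZMod t) (by simp [ZMod.card])
    (fun κ => ![((κ.1, κ.2.1), p κ.2.2.2), ((κ.1, κ.2.2.1), q κ.2.2.2),
      ((κ.1 + 1, κ.2.1 + κ.2.2.1), 0)])
  · simp only [Fintype.card_prod, ZMod.card, Fintype.card_fin]
    rw [show 2 * u - 2 = 2 * (u - 1) by omega]; ring
  · rintro ⟨r, a⟩ ⟨r', b⟩ z hz
    have h3 : r' = r ∨ r' = r + 1 ∨ r = r' + 1 := by revert r r'; decide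
    rcases h3 with rfl | rfl | rfl
    · obtain ⟨k, h | h⟩ := hd z hz
      · exact ⟨(r', a, b, k), 0, 1, by decide, rfl, rfl, h.symm⟩
      · exact ⟨(r', b, a, k), 1, 0, by decide, rfl, rfl, h.symm⟩
    · obtain ⟨k, h | h⟩ := hc z hz
      · exact ⟨(r, a, b - a, k), 0, 2, by decide, rfl, by simp, by simp [h]⟩
      · exact ⟨(r, b - a, a, k), 1, 2, by decide, rfl, by simp, by simp [h]⟩
    · obtain ⟨k, h | h⟩ := hc (-z) (by simpa using hz)
      · exact ⟨(r', b, a - b, k), 2, 0, by decide, by simp, rfl, by simp [← h]⟩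
      · exact ⟨(r', a - b, b, k), 2, 1, by decide, by simp, rfl, by simp [← h]⟩

lemma val_facts (u : ℕ) (hu : 0 < u) (z : ZMod (2 * u)) (hz : 2 • z ≠ 0) :
    ∃ v : ℕ, (v : ZMod (2 * u)) = z ∧ v < 2 * u ∧ v ≠ 0 ∧ v ≠ u := by
  have : NeZero (2 * u) := ⟨by omega⟩
  refine ⟨z.val, ZMod.natCast_zmod_val z, ZMod.val_lt z, ?_, ?_⟩
  · intro h
    rw [ZMod.val_eq_zero] at h
    simp [h] at hz
  · intro h
    have : ((2 * u : ℕ) : ZMod (2 * u)) = 0 := ZMod.natCast_self _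
    apply hz
    rw [← ZMod.natCast_zmod_val z, h, two_smul, ← this]
    push_cast; ring

/-- Case 1 with natural number data. -/
lemma case_one_nat (t u : ℕ) (ht : 0 < t) (hu : 0 < u) (p q : ℕ → ℕ)
    (hd : ∀ d, 1 ≤ d → d < u → p d + d = q d ∨ p d + d = q d + 2 * u)
    (hc : ∀ v, v < 2 * u → v ≠ 0 → v ≠ u → ∃ d, 1 ≤ d ∧ d < u ∧ (v = p d ∨ v = q d)) :
    ∃ C : Finset (Finset (Fin (3 * t) × ZMod (2 * u))),
      IsGRegOOC 3 2 (∅ : Finset (Fin (3 * t))) C ∧ C.card = (3 * t) ^ 2 * (2 * u - 2) / 6 := by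
  have h0 : ((2 * u : ℕ) : ZMod (2 * u)) = 0 := ZMod.natCast_self _
  apply case_one t u ht hu (fun k => (p (k + 1) : ℕ)) (fun k => (q (k + 1) : ℕ))
  · intro z hz
    obtain ⟨v, rfl, h1, h2, h3⟩ := val_facts u hu z hz
    have key : ∀ d, 1 ≤ d → d < u → ((q d : ℕ) : ZMod (2 * u)) - (p d : ℕ) = d := by
      intro d hd1 hd2
      rcases hd d hd1 hd2 with h | h
      · rw [← h]; push_cast; ring
      · have h' := congrArg (fun x : ℕ => (x : ZMod (2 * u))) h
        simp only [Nat.cast_add, h0, add_zero] at h'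
        rw [← h']; ring
    by_cases hvu : v < u
    · refine ⟨⟨v - 1, by omega⟩, Or.inr ?_⟩
      have := key v (by omega) hvu
      simp only [show v - 1 + 1 = v by omega]
      exact this.symm
    · refine ⟨⟨2 * u - v - 1, by omega⟩, Or.inl ?_⟩
      have := key (2 * u - v) (by omega) (by omega)
      simp only [show 2 * u - v - 1 + 1 = 2 * u - v by omega]
      rw [← neg_sub, this, Nat.cast_sub h1.le, h0]; ring
  · intro z hz
    obtain ⟨v, rfl, h1, h2, h3⟩ := val_facts u hu z hz
    obtain ⟨d, hd1, hd2, h⟩ := hc v h1 h2 h3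
    refine ⟨⟨d - 1, by omega⟩, ?_⟩
    simp only [show d - 1 + 1 = d by omega]
    rcases h with h | h
    · left; rw [h]
    · right; rw [h]


lemma case_one_all (t u : ℕ) (ht : 0 < t) (hu4 : u % 4 = 0 ∨ u % 4 = 1) (hu : 4 ≤ u) :
    ∃ C : Finset (Finset (Fin (3 * t) × ZMod (2 * u))),
      IsGRegOOC 3 2 (∅ : Finset (Fin (3 * t))) C ∧ C.card = (3 * t) ^ 2 * (2 * u - 2) / 6 := by
  by_cases h4 : u = 4
  · subst h4
    apply case_one_nat t 4 ht (by norm_num)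
      (fun d => if d = 1 then 1 else if d = 2 then 5 else 3)
      (fun d => if d = 1 then 2 else if d = 2 then 7 else 6)
    · intro d h1 h2
      interval_cases d <;> simp
    · intro v h1 h2 h3
      have : v = 1 ∨ v = 2 ∨ v = 5 ∨ v = 7 ∨ v = 3 ∨ v = 6 := by omega
      rcases this with h | h | h | h | h | h
      · exact ⟨1, by simp [h]⟩
      · exact ⟨1, by simp [h]⟩
      · exact ⟨2, by simp [h]⟩
      · exact ⟨2, by simp [h]⟩
      · exact ⟨3, by simp [h]⟩
      · exact ⟨3, by simp [h]⟩
  by_cases h5 : u = 5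
  · subst h5
    apply case_one_nat t 5 ht (by norm_num)
      (fun d => if d = 1 then 8 else if d = 2 then 1 else if d = 3 then 4 else 2)
      (fun d => if d = 1 then 9 else if d = 2 then 3 else if d = 3 then 7 else 6)
    · intro d h1 h2
      interval_cases d <;> simp
    · intro v h1 h2 h3
      have : v = 8 ∨ v = 9 ∨ v = 1 ∨ v = 3 ∨ v = 4 ∨ v = 7 ∨ v = 2 ∨ v = 6 := by omega
      rcases this with h | h | h | h | h | h | h | h
      · exact ⟨1, by simp [h]⟩
      · exact ⟨1, by simp [h]⟩
      · exact ⟨2, by simp [h]⟩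
      · exact ⟨2, by simp [h]⟩
      · exact ⟨3, by simp [h]⟩
      · exact ⟨3, by simp [h]⟩
      · exact ⟨4, by simp [h]⟩
      · exact ⟨4, by simp [h]⟩
  obtain ⟨k, e, hk, he, rfl⟩ : ∃ k e, 2 ≤ k ∧ e ≤ 1 ∧ u = 4 * k + e :=
    ⟨u / 4, u % 4, by omega, by omega, by omega⟩
  set u := 4 * k + e with hu'
  apply case_one_nat t u ht (by omega)
    (fun d => if d % 2 = 0 then 2 * u - d / 2 else if d = 1 then u + k - 1
      else if d = 2 * k - 1 then u - 2 * k else if d < 2 * k - 1 then u - (d + 1) / 2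
      else u - (d - 1) / 2)
    (fun d => if d % 2 = 0 then d / 2 else if d = 1 then u + k
      else if d = 2 * k - 1 then u - 1 else if d < 2 * k - 1 then u + (d - 1) / 2
      else u + (d + 1) / 2)
  · intro d h1 h2
    split_ifs <;> omega
  · intro v h1 h2 h3
    have fin : ∀ d, 1 ≤ d → d < u →
        (v = (if d % 2 = 0 then 2 * u - d / 2 else if d = 1 then u + k - 1
          else if d = 2 * k - 1 then u - 2 * k else if d < 2 * k - 1 then u - (d + 1) / 2
          else u - (d - 1) / 2) ∨
        v = (if d % 2 = 0 then d / 2 else if d = 1 then u + k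
          else if d = 2 * k - 1 then u - 1 else if d < 2 * k - 1 then u + (d - 1) / 2
          else u + (d + 1) / 2)) → 
        ∃ d, 1 ≤ d ∧ d < u ∧ (v = (if d % 2 = 0 then 2 * u - d / 2 else if d = 1 then u + k - 1
          else if d = 2 * k - 1 then u - 2 * k else if d < 2 * k - 1 then u - (d + 1) / 2
          else u - (d - 1) / 2) ∨
        v = (if d % 2 = 0 then d / 2 else if d = 1 then u + k
          else if d = 2 * k - 1 then u - 1 else if d < 2 * k - 1 then u + (d - 1) / 2
          else u + (d + 1) / 2)) := fun d a b c => ⟨d, a, b, c⟩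
    clear_value u
    by_cases c1 : v ≤ 2 * k - 1 + e
    · apply fin (2 * v) (by omega) (by omega)
      right; split_ifs <;> omega
    by_cases c2 : 2 * u ≤ v + (2 * k - 1 + e)
    · apply fin (2 * (2 * u - v)) (by omega) (by omega)
      left; split_ifs <;> omega
    by_cases c3 : u < v
    · by_cases c4 : v = u + k - 1
      · apply fin 1 (by omega) (by omega)
        left; simpa using c4
      by_cases c5 : v = u + k
      · apply fin 1 (by omega) (by omega)
        right; simpa using c5
      by_cases c6 : v < u + k
      · apply fin (2 * (v - u) + 1) (by omega) (by omega)
        right; split_ifs <;> omega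
      · apply fin (2 * (v - u) - 1) (by omega) (by omega)
        right; split_ifs <;> omega
    · by_cases c4 : v = u - 1
      · apply fin (2 * k - 1) (by omega) (by omega)
        right; split_ifs <;> omega
      by_cases c5 : v = u - 2 * k
      · apply fin (2 * k - 1) (by omega) (by omega)
        left; split_ifs <;> omega
      by_cases c6 : u - v < k
      · apply fin (2 * (u - v) - 1) (by omega) (by omega)
        left; split_ifs <;> omega
      · apply fin (2 * (u - v) + 1) (by omega) (by omega)
        left; split_ifs <;> omega

/-- The embedding of `ZMod 2` as the subgroup of order two. -/
def half (u : ℕ) (s : ZMod 2) : ZMod (2 * u) := if s = 0 then 0 else (u : ZMod (2 * u))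

lemma half_add (u : ℕ) (s s' : ZMod 2) : half u (s + s') = half u s + half u s' := by
  have h0 : ((2 * u : ℕ) : ZMod (2 * u)) = 0 := ZMod.natCast_self _
  have h1 : (u : ZMod (2 * u)) + u = 0 := by rw [← h0]; push_cast; ring
  have hs : s = 0 ∨ s = 1 := by revert s; decide
  have hs' : s' = 0 ∨ s' = 1 := by revert s'; decide
  have h2 : (1 : ZMod 2) + 1 = 0 := by decide
  rcases hs with rfl | rfl <;> rcases hs' with rfl | rfl <;> simp [half, h1, h2]

lemma half_neg (u : ℕ) (s : ZMod 2) : - half u s = half u s := by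
  have h := half_add u s s
  rw [show s + s = 0 by clear h; revert s; decide] at h
  exact neg_eq_of_add_eq_zero_left (h.symm.trans (by simp [half]))

lemma rep_two (u : ℕ) (hu : u % 2 = 1) (z : ZMod (2 * u)) (hz : 2 • z ≠ 0) :
    ∃ (s : ZMod 2) (k : Fin ((u - 1) / 2)),
      z = half u s + ((2 * (k + 1) : ℕ) : ZMod (2 * u)) ∨
      z = half u s - ((2 * (k + 1) : ℕ) : ZMod (2 * u)) := by
  have h0 : ((2 * u : ℕ) : ZMod (2 * u)) = 0 := ZMod.natCast_self _
  obtain ⟨v, rfl, h1, h2, h3⟩ := val_facts u (by omega) z hz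
  by_cases hv : v % 2 = 0
  · by_cases hvu : v < u
    · refine ⟨0, ⟨v / 2 - 1, by omega⟩, Or.inl ?_⟩
      simp only [half, if_true, zero_add]
      congr 1; omega
    · refine ⟨0, ⟨(2 * u - v) / 2 - 1, by omega⟩, Or.inr ?_⟩
      simp only [half, if_true, zero_sub]
      rw [eq_neg_iff_add_eq_zero, ← Nat.cast_add, ← h0]
      congr 1; omega
  · by_cases hvu : u < v
    · refine ⟨1, ⟨(v - u) / 2 - 1, by omega⟩, Or.inl ?_⟩
      simp only [half, one_ne_zero, if_false]
      rw [← Nat.cast_add]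
      congr 1; omega
    · refine ⟨1, ⟨(u - v) / 2 - 1, by omega⟩, Or.inr ?_⟩
      simp only [half, one_ne_zero, if_false]
      rw [eq_sub_iff_add_eq, ← Nat.cast_add]
      congr 1; omega

lemma rep_four (u : ℕ) (hu : u % 2 = 1) (z : ZMod (2 * u)) (hz : 2 • z ≠ 0) :
    ∃ (s : ZMod 2) (k : Fin ((u - 1) / 2)),
      z = half u s + ((4 * (k + 1) : ℕ) : ZMod (2 * u)) ∨
      z = half u s - ((4 * (k + 1) : ℕ) : ZMod (2 * u)) := by
  have h0 : ((2 * u : ℕ) : ZMod (2 * u)) = 0 := ZMod.natCast_self _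
  have key : ∀ w : ℕ, w % 2 = 0 → 0 < w → w < 2 * u → ∃ k : Fin ((u - 1) / 2),
      (w : ZMod (2 * u)) = ((4 * (k + 1) : ℕ) : ZMod (2 * u)) ∨
      (w : ZMod (2 * u)) = - ((4 * (k + 1) : ℕ) : ZMod (2 * u)) := by
    intro w h1 h2 h3
    by_cases h4 : w % 4 = 0
    · refine ⟨⟨w / 4 - 1, by omega⟩, Or.inl ?_⟩
      congr 1; simp only; omega
    · refine ⟨⟨(2 * u - w) / 4 - 1, by omega⟩, Or.inr ?_⟩
      rw [eq_neg_iff_add_eq_zero, ← Nat.cast_add, ← h0]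
      congr 1; simp only; omega
  have fin : ∀ (s : ZMod 2) (w : ℕ), w % 2 = 0 → 0 < w → w < 2 * u → z = half u s + w →
      ∃ (s : ZMod 2) (k : Fin ((u - 1) / 2)),
      z = half u s + ((4 * (k + 1) : ℕ) : ZMod (2 * u)) ∨
      z = half u s - ((4 * (k + 1) : ℕ) : ZMod (2 * u)) := by
    intro s w h1 h2 h3 h4
    obtain ⟨k, h | h⟩ := key w h1 h2 h3
    · exact ⟨s, k, Or.inl (by rw [h4, h])⟩
    · exact ⟨s, k, Or.inr (by rw [h4, h, sub_eq_add_neg])⟩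
  obtain ⟨v, hvz, h1, h2, h3⟩ := val_facts u (by omega) z hz
  by_cases hv : v % 2 = 0
  · exact fin 0 v hv (by omega) h1 (by simp [half, hvz])
  · by_cases hvu : u < v
    · refine fin 1 (v - u) (by omega) (by omega) (by omega) ?_
      simp only [half, one_ne_zero, if_false]
      rw [← Nat.cast_add, ← hvz]
      congr 1; omega
    · refine fin 1 (v + u) (by omega) (by omega) (by omega) ?_
      simp only [half, one_ne_zero, if_false]
      rw [← Nat.cast_add, ← hvz, ← add_zero (v : ZMod (2 * u)), ← h0, ← Nat.cast_add]
      congr 1; omega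

lemma case_two (t u : ℕ) (ht : 0 < t) (hu : u % 2 = 1) :
    ∃ C : Finset (Finset (Fin (6 * t) × ZMod (2 * u))),
      IsGRegOOC 3 2 (∅ : Finset (Fin (6 * t))) C ∧ C.card = (6 * t) ^ 2 * (2 * u - 2) / 6 := by
  have : NeZero t := ⟨ht.ne'⟩
  apply main_lemma (6 * t) u (by omega)
    (K := ZMod 3 × ZMod t × ZMod t × ZMod 2 × ZMod 2 × ZMod 2 × Fin ((u - 1) / 2))
    (R := ZMod 3 × ZMod t × ZMod 2)
    (by simp only [Fintype.card_prod, ZMod.card]; ring)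
    (fun ⟨r, α, β, v, a, s, k⟩ =>
      ![((r, α, v + a), half u s + ((2 * (k + 1) : ℕ) : ZMod (2 * u))),
        ((r, β, v + s), half u (a + s) - ((2 * (k + 1) : ℕ) : ZMod (2 * u))),
        ((r + 1, α + β, v), 0)])
  · simp only [Fintype.card_prod, ZMod.card, Fintype.card_fin]
    obtain ⟨c, rfl⟩ : ∃ c, u = 2 * c + 1 := ⟨u / 2, by omega⟩
    rw [show (2 * c + 1 - 1) / 2 = c by omega, show 2 * (2 * c + 1) - 2 = 4 * c by omega]; ring
  · rintro ⟨r, a, j⟩ ⟨r', b, j'⟩ z hz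
    have h3 : r' = r ∨ r' = r + 1 ∨ r = r' + 1 := by revert r r'; decide
    have f1 : ∀ j s : ZMod 2, j + s + s = j := by decide
    have f2 : ∀ j j' s : ZMod 2, j + s + (j + j' + s) = j' := by decide
    have f3 : ∀ j j' s : ZMod 2, j' + s + (j + j' + s) = j := by decide
    have e3 : ∀ j j' ε : ZMod 2, ε + j + j' + (j - j') = ε := by decide
    rcases h3 with rfl | rfl | rfl
    · obtain ⟨ε, k, h | h⟩ := rep_four u hu z hz
      · refine ⟨(r', a, b, j + ε, ε, j + j' + ε, k), 0, 1, by decide, ?_, ?_, ?_⟩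
        · simp [show j + ε + ε = j from f1 _ _]
        · simp [show j + ε + (j + j' + ε) = j' from f2 _ _ _]
        · simp only [Matrix.cons_val_zero, Matrix.cons_val_one]
          have e4 : half u (ε + (j + j' + ε)) = half u ε + half u (j + j' + ε) := half_add _ _ _
          have e5 := half_neg u ε
          rw [h, e4]; nth_rewrite 2 [← e5]
          push_cast; ring
      · refine ⟨(r', b, a, j' + ε, ε, j + j' + ε, k), 1, 0, by decide, ?_, ?_, ?_⟩
        · simp [show j' + ε + (j + j' + ε) = j from f3 _ _ _]
        · simp [show j' + ε + ε = j' from f1 _ _]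
        · simp only [Matrix.cons_val_zero, Matrix.cons_val_one]
          rw [h, half_add u ε (j + j' + ε)]
          push_cast; ring
    · obtain ⟨ε, k, h | h⟩ := rep_two u hu z hz
      · refine ⟨(r, a, b - a, j', j - j', ε, k), 0, 2, by decide, ?_, ?_, ?_⟩
        · simp
        · simp
        · simpa using h.symm
      · refine ⟨(r, b - a, a, j', ε + j + j', j - j', k), 1, 2, by decide, ?_, ?_, ?_⟩
        · simp
        · simp
        · simpa [e3] using h.symm
    · obtain ⟨ε, k, h | h⟩ := rep_two u hu (-z) (by simpa using hz)
      · refine ⟨(r', b, a - b, j, j' - j, ε, k), 2, 0, by decide, ?_, ?_, ?_⟩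
        · simp
        · simp
        · rw [neg_eq_iff_eq_neg, eq_comm] at h
          simpa using h
      · refine ⟨(r', a - b, b, j, ε + j' + j, j' - j, k), 2, 1, by decide, ?_, ?_, ?_⟩
        · simp
        · simp
        · rw [neg_eq_iff_eq_neg, eq_comm] at h
          simpa [e3] using h

theorem stmt_13 (m n : ℕ)
    (h : (m % 6 = 3 ∧ (n % 8 = 0 ∨ n % 8 = 2) ∧ 8 ≤ n) ∨
         (m % 12 = 6 ∧ n % 4 = 2 ∧ 6 ≤ n)) :
    ∃ C : Finset (Finset (Fin m × ZMod n)),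
      IsGRegOOC 3 2 (∅ : Finset (Fin m)) C ∧ C.card = m ^ 2 * (n - 2) / 6 := by
  rcases h with ⟨h1, h2, h3⟩ | ⟨h1, h2, h3⟩
  · obtain ⟨t, rfl⟩ : ∃ t, m = 3 * t := ⟨m / 3, by omega⟩
    obtain ⟨u, rfl⟩ : ∃ u, n = 2 * u := ⟨n / 2, by omega⟩
    exact case_one_all t u (by omega) (by omega) (by omega)
  · obtain ⟨t, rfl⟩ : ∃ t, m = 6 * t := ⟨m / 6, by omega⟩
    obtain ⟨u, rfl⟩ : ∃ u, n = 2 * u := ⟨n / 2, by omega⟩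
    exact case_two t u (by omega) (by omega)
end

section
/- Let m ≡ r (mod 12) with r ∈ {1, 2, 4, 5, 7, 8, 10, 11} and m ≥ 13. Then for every positive integer n with n ≡ 0 or 2 (mod 8) and n ≥ 8, there exists a 2-regular 2-D ([m:r]×n,3,1)-OOC with Υ(m,r,n,2,3) = (m²−r²)(n−2)/6 codewords. -/
/-- The pair set `E` can be covered by triples without waste. -/
def Cov (n : ℕ) {α : Type} [DecidableEq α] (E : Finset (α × α)) : Prop :=
  ∃ (κ : Type) (_ : Fintype κ) (p : κ → Fin 3 → α × ZMod n),
    6 * Fintype.card κ ≤ E.card * (n - 2) ∧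
    ∀ i j z, (i, j) ∈ E → (2 : ℕ) • z ≠ 0 →
      ∃ k a b, a ≠ b ∧ (p k a).1 = i ∧ (p k b).1 = j ∧ (p k a).2 - (p k b).2 = z

lemma two_smul_eq_zero_iff (n : ℕ) [NeZero n] (hn : n % 2 = 0) (z : ZMod n) :
    (2 : ℕ) • z = 0 ↔ z = 0 ∨ z = ((n / 2 : ℕ) : ZMod n) := by
  have hz := ZMod.natCast_zmod_val z
  have hlt := ZMod.val_lt z
  constructor
  · intro h
    rw [← hz, nsmul_eq_mul, ← Nat.cast_mul, ZMod.natCast_eq_zero_iff] at h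
    obtain ⟨c, hc⟩ := h
    have : c = 0 ∨ c = 1 := by
      have : c < 2 := by
        by_contra hcc
        have : n * 2 ≤ n * c := Nat.mul_le_mul_left n (by omega)
        omega
      omega
    rcases this with rfl | rfl
    · left; rw [← hz]; have : z.val = 0 := by omega
      rw [this]; simp
    · right; rw [← hz]; congr 1; omega
  · rintro (rfl | rfl)
    · simp
    · rw [nsmul_eq_mul, ← Nat.cast_mul, ZMod.natCast_eq_zero_iff]
      exact ⟨1, by omega⟩

lemma card_D (n : ℕ) [NeZero n] (hn : n % 2 = 0) :
    ((Finset.univ : Finset (ZMod n)).filter fun z => (2 : ℕ) • z ≠ 0).card = n - 2 := by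
  have h1 := Finset.card_filter_add_card_filter_not (s := (Finset.univ : Finset (ZMod n)))
    (p := fun z => (2 : ℕ) • z = 0)
  have h2 : ((Finset.univ : Finset (ZMod n)).filter fun z => (2 : ℕ) • z = 0).card = 2 := by
    have : ((Finset.univ : Finset (ZMod n)).filter fun z => (2 : ℕ) • z = 0)
        = {0, ((n / 2 : ℕ) : ZMod n)} := by
      ext z; simp [two_smul_eq_zero_iff n hn z, -nsmul_eq_mul]
    rw [this, Finset.card_pair]
    intro h
    have := (ZMod.natCast_eq_zero_iff (n / 2) n).1 h.symm
    have h3 := NeZero.ne n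
    have := Nat.le_of_dvd (by omega) this
    omega
  rw [Finset.card_univ, ZMod.card, h2] at h1
  simp only [ne_eq]
  omega

lemma card_offdiag3 : ((Finset.univ : Finset (Fin 3 × Fin 3)).filter
    fun t => t.1 ≠ t.2).card = 6 := by decide

lemma code_of_cov (m n : ℕ) [NeZero n] (hn : n % 2 = 0) (E : Finset (Fin m × Fin m))
    (h : Cov n E) :
    ∃ C : Finset (Finset (Fin m × ZMod n)), (∀ A ∈ C, A.card = 3) ∧
      (∀ i j z, Multiset.count z (Delta i j C) =
        if (i, j) ∈ E ∧ (2 : ℕ) • z ≠ 0 then 1 else 0) ∧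
      6 * C.card = E.card * (n - 2) := by
  classical
  obtain ⟨κ, _, p, hcard, hcov⟩ := h
  let F : Finset (κ × (Fin 3 × Fin 3)) :=
    Finset.univ ×ˢ ((Finset.univ : Finset (Fin 3 × Fin 3)).filter fun t => t.1 ≠ t.2)
  let Φ : κ × (Fin 3 × Fin 3) → (Fin m × Fin m) × ZMod n := fun t =>
    (((p t.1 t.2.1).1, (p t.1 t.2.2).1), (p t.1 t.2.1).2 - (p t.1 t.2.2).2)
  let S : Finset ((Fin m × Fin m) × ZMod n) :=
    E ×ˢ ((Finset.univ : Finset (ZMod n)).filter fun z => (2 : ℕ) • z ≠ 0)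
  have hFcard : F.card = 6 * Fintype.card κ := by
    rw [Finset.card_product, card_offdiag3, Finset.card_univ, mul_comm]
  have hScard : S.card = E.card * (n - 2) := by
    rw [Finset.card_product, card_D n hn]
  have hSF : S ⊆ F.image Φ := by
    rintro ⟨⟨i, j⟩, z⟩ hx
    simp only [S, Finset.mem_product, Finset.mem_filter, Finset.mem_univ, true_and] at hx
    obtain ⟨k, a, b, hab, h1, h2, h3⟩ := hcov i j z hx.1 hx.2
    refine Finset.mem_image.2 ⟨(k, a, b), ?_, ?_⟩
    · simp [F, hab]
    · simp [Φ, h1, h2, h3]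
  have hle : (F.image Φ).card ≤ F.card := Finset.card_image_le
  have hSeq : S = F.image Φ := Finset.eq_of_subset_of_card_le hSF (by omega)
  have hFeq : (F.image Φ).card = F.card := by
    have := Finset.card_le_card hSF; omega
  have hinj : Set.InjOn Φ F := Finset.card_image_iff.1 hFeq
  have hmemF : ∀ k a b, a ≠ b → (k, a, b) ∈ F := by
    intro k a b hab; simp [F, hab]
  have hpinj : ∀ k, Function.Injective (p k) := by
    intro k a b hab
    by_contra hne
    have : Φ (k, a, b) ∈ S := by
      rw [hSeq]; exact Finset.mem_image_of_mem _ (hmemF k a b hne)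
    simp only [S, Finset.mem_product, Finset.mem_filter] at this
    apply this.2.2
    simp [Φ, hab]
  let B : κ → Finset (Fin m × ZMod n) := fun k => Finset.univ.image (p k)
  have hBinj : Function.Injective B := by
    intro k k' hkk
    have h0 : p k 0 ∈ B k' := by
      rw [← hkk]; exact Finset.mem_image_of_mem _ (Finset.mem_univ _)
    have h1 : p k 1 ∈ B k' := by
      rw [← hkk]; exact Finset.mem_image_of_mem _ (Finset.mem_univ _)
    obtain ⟨a, _, ha⟩ := Finset.mem_image.1 h0
    obtain ⟨b, _, hb⟩ := Finset.mem_image.1 h1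
    have hab : a ≠ b := by
      rintro rfl
      exact absurd (hpinj k (ha.symm.trans hb)) (by decide)
    have := hinj (Finset.mem_coe.2 (hmemF k 0 1 (by decide)))
      (Finset.mem_coe.2 (hmemF k' a b hab)) (by simp [Φ, ha, hb])
    exact (Prod.ext_iff.1 this).1
  refine ⟨Finset.univ.image B, ?_, ?_, ?_⟩
  · intro A hA
    obtain ⟨k, _, rfl⟩ := Finset.mem_image.1 hA
    rw [Finset.card_image_of_injective _ (hpinj k)]; simp
  · intro i j z
    have e1 : Multiset.count z (Delta i j (Finset.univ.image B)) =
        ∑ k : κ, ((Finset.univ : Finset (Fin 3 × Fin 3)).filter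
          fun t => t.1 ≠ t.2 ∧ Φ (k, t) = ((i, j), z)).card := by
      unfold Delta
      rw [Finset.sum_image (fun x _ y _ h => hBinj h), Multiset.count_sum']
      refine Finset.sum_congr rfl fun k _ => ?_
      rw [Multiset.count_map, ← Finset.filter_val, Finset.filter_filter, Finset.card_val]
      symm
      refine Finset.card_bij (fun t _ => (p k t.1, p k t.2)) ?_ ?_ ?_
      · rintro ⟨a, b⟩ ht
        simp only [Finset.mem_filter, Finset.mem_univ, true_and, Φ, Prod.mk.injEq] at ht
        simp only [Finset.mem_filter, Finset.mem_product]
        refine ⟨⟨Finset.mem_image_of_mem _ (Finset.mem_univ _),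
          Finset.mem_image_of_mem _ (Finset.mem_univ _)⟩,
          ⟨(hpinj k).ne ht.1, ht.2.1.1, ht.2.1.2⟩, ht.2.2.symm⟩
      · rintro ⟨a, b⟩ _ ⟨a', b'⟩ _ h
        simp only [Prod.mk.injEq] at h
        rw [hpinj k h.1, hpinj k h.2]
      · rintro ⟨u, v⟩ huv
        simp only [Finset.mem_filter, Finset.mem_product] at huv
        obtain ⟨⟨hu, hv⟩, ⟨hne, hi, hj⟩, hz⟩ := huv
        obtain ⟨a, _, rfl⟩ := Finset.mem_image.1 hu
        obtain ⟨b, _, rfl⟩ := Finset.mem_image.1 hv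
        refine ⟨(a, b), ?_, rfl⟩
        simp only [Finset.mem_filter, Finset.mem_univ, true_and, Φ, Prod.mk.injEq]
        exact ⟨fun h => hne (by rw [h]), ⟨hi, hj⟩, hz.symm⟩
    have e2 : ∑ k : κ, ((Finset.univ : Finset (Fin 3 × Fin 3)).filter
          fun t => t.1 ≠ t.2 ∧ Φ (k, t) = ((i, j), z)).card =
        (F.filter fun t => Φ t = ((i, j), z)).card := by
      rw [← Finset.card_sigma]
      refine Finset.card_bij (fun t _ => (t.1, t.2)) ?_ ?_ ?_
      · rintro ⟨k, a, b⟩ ht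
        simp only [Finset.mem_sigma, Finset.mem_filter, Finset.mem_univ, true_and] at ht
        simp only [Finset.mem_filter]
        exact ⟨hmemF k a b ht.1, ht.2⟩
      · rintro ⟨k, a⟩ _ ⟨k', a'⟩ _ h
        simp only [Prod.mk.injEq] at h
        obtain ⟨rfl, rfl⟩ := h; rfl
      · rintro ⟨k, a, b⟩ ht
        simp only [Finset.mem_filter, F, Finset.mem_product, Finset.mem_univ, true_and] at ht
        exact ⟨⟨k, a, b⟩, by simp [ht.1, ht.2], rfl⟩
    rw [e1, e2]
    split_ifs with hc
    · have : ((i, j), z) ∈ F.image Φ := by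
        rw [← hSeq]; simp only [S, Finset.mem_product, Finset.mem_filter, Finset.mem_univ,
          true_and]; exact hc
      obtain ⟨t, ht, hte⟩ := Finset.mem_image.1 this
      rw [Finset.card_eq_one]
      refine ⟨t, ?_⟩
      ext t'
      simp only [Finset.mem_filter, Finset.mem_singleton]
      constructor
      · rintro ⟨h1, h2⟩; exact hinj h1 ht (h2.trans hte.symm)
      · rintro rfl; exact ⟨ht, hte⟩
    · rw [Finset.card_eq_zero, Finset.filter_eq_empty_iff]
      intro t ht hte
      have : ((i, j), z) ∈ S := by rw [hSeq, ← hte]; exact Finset.mem_image_of_mem _ ht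
      simp only [S, Finset.mem_product, Finset.mem_filter, Finset.mem_univ, true_and] at this
      exact hc this
  · rw [Finset.card_image_of_injective _ hBinj, Finset.card_univ, ← hScard, hSeq, hFeq, hFcard]

/-- Gluing. -/
lemma Cov.glue {n : ℕ} {α ι : Type} [DecidableEq α] (s : Finset ι)
    (P : ι → Finset (α × α)) (hP : ∀ b ∈ s, Cov n (P b)) (E : Finset (α × α))
    (hE : ∀ x ∈ E, ∃ b ∈ s, x ∈ P b) (hc : ∑ b ∈ s, (P b).card ≤ E.card) : Cov n E := by
  classical
  choose κ hκ p h1 h2 using fun b : s => hP b.1 b.2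
  refine ⟨(b : s) × κ b, inferInstance, fun k => p k.1 k.2, ?_, ?_⟩
  · rw [Fintype.card_sigma, Finset.mul_sum]
    calc ∑ b : s, 6 * Fintype.card (κ b) ≤ ∑ b : s, (P b.1).card * (n - 2) :=
          Finset.sum_le_sum fun b _ => h1 b
      _ = (∑ b ∈ s, (P b).card) * (n - 2) := by
          rw [← Finset.sum_mul, Finset.sum_coe_sort s (fun b => (P b).card)]
      _ ≤ _ := Nat.mul_le_mul_right _ hc
  · intro i j z hij hz
    obtain ⟨b, hb, hx⟩ := hE _ hij
    obtain ⟨k, a, c, h⟩ := h2 ⟨b, hb⟩ i j z hx hz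
    exact ⟨⟨⟨b, hb⟩, k⟩, a, c, h⟩

lemma Cov.map {n : ℕ} {α β : Type} [DecidableEq α] [DecidableEq β] (φ : α → β)
    (hφ : Function.Injective φ) {E : Finset (α × α)} (h : Cov n E) :
    Cov n (E.image (Prod.map φ φ)) := by
  obtain ⟨κ, hκ, p, h1, h2⟩ := h
  refine ⟨κ, hκ, fun k a => (φ (p k a).1, (p k a).2), ?_, ?_⟩
  · rwa [Finset.card_image_of_injective _ (hφ.prodMap hφ)]
  · intro i j z hij hz
    obtain ⟨⟨i', j'⟩, hm, he⟩ := Finset.mem_image.1 hij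
    simp only [Prod.map, Prod.mk.injEq] at he
    obtain ⟨rfl, rfl⟩ := he
    obtain ⟨k, a, b, hab, e1, e2, e3⟩ := h2 i' j' z hm hz
    exact ⟨k, a, b, hab, by simp [e1], by simp [e2], e3⟩

lemma two_inv {V : Type} (π ν : V → V) (hπ : ∀ v, π (π v) = v) (hν : ∀ v, ν (ν v) = v)
    (hπ' : ∀ v, π v ≠ v) (hν' : ∀ v, ν v ≠ v) :
    ∃ A : Set V, ∀ v, (π v ∈ A ↔ v ∉ A) ∧ (ν v ∈ A ↔ v ∉ A) := by
  classical
  let P : Equiv.Perm V := ⟨π, π, hπ, hπ⟩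
  let N : Equiv.Perm V := ⟨ν, ν, hν, hν⟩
  have hPP : P * P = 1 := by ext v; exact hπ v
  have hNN : N * N = 1 := by ext v; exact hν v
  have hPi : P⁻¹ = P := inv_eq_of_mul_eq_one_left hPP
  have hNi : N⁻¹ = N := inv_eq_of_mul_eq_one_left hNN
  let σ : Equiv.Perm V := N * P
  have hconj : ∀ k : ℤ, N * σ ^ k = σ ^ (-k) * N := by
    intro k
    have h1 : N * σ * N⁻¹ = σ⁻¹ := by
      simp only [σ, mul_inv_rev, hPi, hNi]
      rw [← mul_assoc, hNN, one_mul]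
    have h2 : N * σ ^ k * N⁻¹ = σ ^ (-k) := by
      rw [← conj_zpow, h1, inv_zpow, zpow_neg]
    rw [← h2]; simp
  have hPN : P = N * σ := by simp only [σ]; rw [← mul_assoc, hNN, one_mul]
  -- no cycle contains both v and N v
  have key : ∀ v, ¬ σ.SameCycle v (ν v) := by
    rintro v ⟨k, hk⟩
    have hk' : (σ ^ k) v = N v := hk
    rcases Int.even_or_odd' k with ⟨l, rfl | rfl⟩
    · apply hν' ((σ ^ l) v)
      have : (N * σ ^ l) v = (σ ^ l) v := by
        rw [hconj, Equiv.Perm.mul_apply, ← hk', ← Equiv.Perm.mul_apply, ← zpow_add]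
        congr 2; ring
      exact this
    · apply hπ' ((σ ^ l) v)
      have : (P * σ ^ l) v = (σ ^ l) v := by
        have e : P * σ ^ l = N * σ ^ (1 + l) := by
          rw [hPN, mul_assoc, zpow_add, zpow_one]
        rw [e, hconj, Equiv.Perm.mul_apply, ← hk', ← Equiv.Perm.mul_apply, ← zpow_add]
        congr 2; ring
      exact this
  let S := Equiv.Perm.SameCycle.setoid σ
  letI : LinearOrder (Quotient S) := linearOrderOfSTO WellOrderingRel
  let q : V → Quotient S := fun v => Quotient.mk S v
  have hq : ∀ v w, q v = q w ↔ σ.SameCycle v w := fun v w => Quotient.eq (r := S)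
  have hNq : ∀ v w, q v = q w → q (ν v) = q (ν w) := by
    intro v w h
    obtain ⟨k, hk⟩ := (hq _ _).1 h
    refine (hq _ _).2 ⟨-k, ?_⟩
    have : (σ ^ (-k) * N) v = N w := by
      rw [← hconj, Equiv.Perm.mul_apply, hk]
    exact this
  have hπq : ∀ v, q (π v) = q (ν v) := by
    intro v
    refine ((hq _ _).2 ⟨1, ?_⟩)
    have : (σ ^ (1 : ℤ) * P) v = N v := by
      simp only [σ, zpow_one]
      rw [mul_assoc, hPP, mul_one]
    exact this
  have hne : ∀ v, q v ≠ q (ν v) := fun v h => key v ((hq _ _).1 h)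
  refine ⟨{v | q v < q (ν v)}, fun v => ⟨?_, ?_⟩⟩
  · simp only [Set.mem_setOf_eq, not_lt]
    rw [hNq _ _ (hπq v), hν, hπq]
    exact ⟨le_of_lt, fun h => lt_of_le_of_ne h (hne v).symm⟩
  · simp only [Set.mem_setOf_eq, not_lt]
    rw [hν]
    exact ⟨le_of_lt, fun h => lt_of_le_of_ne h (hne v).symm⟩

/-- Rosa-type data with orientation. -/
def RData (n : ℕ) : Prop :=
  ∃ (ι : Type) (_ : Fintype ι) (X Y : ι → ZMod n), 2 * Fintype.card ι ≤ n - 2 ∧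
    ∀ z : ZMod n, (2 : ℕ) • z ≠ 0 →
      (∃ l, X l = z ∨ Y l = z) ∧ (∃ l, Y l - X l = z ∨ X l - Y l = z) ∧
      (∃ l, X l = z ∨ - X l = z) ∧ (∃ l, Y l = z ∨ - Y l = z)

lemma RData.of_rosa (n : ℕ) [NeZero n] (hn : n % 2 = 0) (ι : Type) [Fintype ι]
    (X Y : ι → ZMod n) (hc : 2 * Fintype.card ι ≤ n - 2)
    (h1 : ∀ z : ZMod n, (2 : ℕ) • z ≠ 0 → ∃ l, X l = z ∨ Y l = z)
    (h2 : ∀ z : ZMod n, (2 : ℕ) • z ≠ 0 → ∃ l, Y l - X l = z ∨ X l - Y l = z) : RData n := by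
  classical
  let e : ι ⊕ ι → ZMod n := Sum.elim X Y
  let D := (Finset.univ : Finset (ZMod n)).filter fun z => (2 : ℕ) • z ≠ 0
  have hD : D.card = n - 2 := card_D n hn
  have hsub : D ⊆ Finset.univ.image e := by
    intro z hz
    obtain ⟨l, hl | hl⟩ := h1 z (Finset.mem_filter.1 hz).2
    · exact Finset.mem_image.2 ⟨Sum.inl l, Finset.mem_univ _, hl⟩
    · exact Finset.mem_image.2 ⟨Sum.inr l, Finset.mem_univ _, hl⟩
  have hle : (Finset.univ.image e).card ≤ (Finset.univ : Finset (ι ⊕ ι)).card :=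
    Finset.card_image_le
  have hV : (Finset.univ : Finset (ι ⊕ ι)).card = 2 * Fintype.card ι := by
    rw [Finset.card_univ, Fintype.card_sum]; ring
  have heq : D = Finset.univ.image e := Finset.eq_of_subset_of_card_le hsub (by omega)
  have hinj : Function.Injective e := by
    have : (Finset.univ.image e).card = (Finset.univ : Finset (ι ⊕ ι)).card := by
      have := Finset.card_le_card hsub; omega
    have := Finset.card_image_iff.1 this
    simpa using this
  have hmem : ∀ v, (2 : ℕ) • e v ≠ 0 := by
    intro v
    have : e v ∈ D := by rw [heq]; exact Finset.mem_image_of_mem _ (Finset.mem_univ _)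
    exact (Finset.mem_filter.1 this).2
  have hsurj : ∀ z : ZMod n, (2 : ℕ) • z ≠ 0 → ∃ v, e v = z := by
    intro z hz
    have : z ∈ Finset.univ.image e := hsub (by simpa [D] using hz)
    obtain ⟨v, _, hv⟩ := Finset.mem_image.1 this
    exact ⟨v, hv⟩
  have hneg : ∀ v, ∃ w, e w = - e v := by
    intro v; apply hsurj; rw [smul_neg, neg_ne_zero]; exact hmem v
  choose ν hν using hneg
  obtain ⟨A, hA⟩ := two_inv (Sum.swap : ι ⊕ ι → ι ⊕ ι) ν (fun v => Sum.swap_swap v)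
    (fun v => hinj (by rw [hν, hν, neg_neg]))
    (by rintro (l | l) <;> simp [Sum.swap])
    (by
      intro v hv
      apply hmem v
      have := hν v
      rw [hv] at this
      rw [two_nsmul]; nth_rewrite 1 [this]; simp)
  let X' : ι → ZMod n := fun l => if Sum.inl l ∈ A then X l else Y l
  let Y' : ι → ZMod n := fun l => if Sum.inl l ∈ A then Y l else X l
  have hXA : ∀ v ∈ A, ∃ l, X' l = e v := by
    rintro (l | l) hv
    · exact ⟨l, by simp [X', hv, e]⟩
    · refine ⟨l, ?_⟩
      have : Sum.inl l ∉ A := (hA (Sum.inl l)).1.1 hv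
      simp [X', this, e]
  have hYA : ∀ v, v ∉ A → ∃ l, Y' l = e v := by
    rintro (l | l) hv
    · exact ⟨l, by simp [Y', hv, e]⟩
    · refine ⟨l, ?_⟩
      have : Sum.inl l ∈ A := by
        by_contra h
        exact hv ((hA (Sum.inl l)).1.2 h)
      simp [Y', this, e]
  refine ⟨ι, inferInstance, X', Y', hc, fun z hz => ⟨?_, ?_, ?_, ?_⟩⟩
  · obtain ⟨l, h⟩ := h1 z hz
    refine ⟨l, ?_⟩
    by_cases hl : Sum.inl l ∈ A <;> simp only [X', Y', hl, if_true, if_false] <;> tauto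
  · obtain ⟨l, h⟩ := h2 z hz
    refine ⟨l, ?_⟩
    by_cases hl : Sum.inl l ∈ A <;> simp only [X', Y', hl, if_true, if_false] <;> tauto
  · obtain ⟨v, rfl⟩ := hsurj z hz
    by_cases hv : v ∈ A
    · obtain ⟨l, hl⟩ := hXA v hv; exact ⟨l, Or.inl hl⟩
    · obtain ⟨l, hl⟩ := hXA (ν v) ((hA v).2.2 hv)
      exact ⟨l, Or.inr (by rw [hl, hν, neg_neg])⟩
  · obtain ⟨v, rfl⟩ := hsurj z hz
    by_cases hv : v ∈ A
    · obtain ⟨l, hl⟩ := hYA (ν v) (fun h => (hA v).2.1 h hv)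
      exact ⟨l, Or.inr (by rw [hl, hν, neg_neg])⟩
    · obtain ⟨l, hl⟩ := hYA v hv; exact ⟨l, Or.inl hl⟩

/-- Left end of the pair with difference `d` (with `h = n / 2`). -/
def rosaX (h k d : ℤ) : ℤ :=
  if d % 2 = 0 then -(d / 2)
  else if 2 * k + 1 ≤ d then h - (d + 1) / 2
  else if d = 2 * k - 1 then h + 1
  else if d = 1 then h - k
  else h - (d - 1) / 2

lemma rosaX_cover (n h k v : ℤ) (hk : 2 ≤ k) (hh : n = 2 * h) (hn : n = 8 * k ∨ n = 8 * k + 2)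
    (h1 : 1 ≤ v) (h2 : v < n) (h3 : v ≠ h) :
    ∃ d, 1 ≤ d ∧ d < h ∧ (rosaX h k d = v ∨ rosaX h k d = v - n ∨
      rosaX h k d + d = v ∨ rosaX h k d + d = v - n) := by
  have main : ∃ d, 1 ≤ d ∧ d < h ∧
     ((d % 2 = 0 ∧ (d / 2 = v ∨ -(d/2) = v - n)) ∨
      (d % 2 = 1 ∧ 2 * k + 1 ≤ d ∧ (h - (d + 1) / 2 = v ∨ h - (d + 1) / 2 + d = v)) ∨
      (d = 2 * k - 1 ∧ (h + 1 = v ∨ h + 1 + d = v)) ∨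
      (d = 1 ∧ (h - k = v ∨ h - k + 1 = v)) ∨
      (d % 2 = 1 ∧ d < 2 * k - 1 ∧ 1 < d ∧ (h - (d - 1) / 2 = v ∨ h - (d - 1) / 2 + d = v))) := by
    by_cases c1 : 2 * v < h
    · exact ⟨2 * v, by omega, by omega, by omega⟩
    by_cases c2 : 2 * (n - v) < h
    · exact ⟨2 * (n - v), by omega, by omega, by omega⟩
    by_cases c3 : v = h + 1 ∨ v = h + 2 * k
    · exact ⟨2 * k - 1, by omega, by omega, by omega⟩
    by_cases c4 : v ≤ h - k - 1
    · exact ⟨-1 - 2 * (v - h), by omega, by omega, by omega⟩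
    by_cases c5 : h + k ≤ v
    · exact ⟨2 * (v - h) + 1, by omega, by omega, by omega⟩
    by_cases c6 : v = h - k ∨ v = h - k + 1
    · exact ⟨1, by omega, by omega, by omega⟩
    by_cases c7 : v < h
    · exact ⟨1 - 2 * (v - h), by omega, by omega, by omega⟩
    · exact ⟨2 * (v - h) - 1, by omega, by omega, by omega⟩
  obtain ⟨d, hd1, hd2, hd⟩ := main
  refine ⟨d, hd1, hd2, ?_⟩
  unfold rosaX
  split_ifs <;> omega

lemma rdata_general (n k : ℕ) (hk : 2 ≤ k) (hn : n = 8 * k ∨ n = 8 * k + 2) : RData n := by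
  haveI : NeZero n := ⟨by omega⟩
  have hn2 : n % 2 = 0 := by omega
  have hval : ∀ z : ZMod n, (2 : ℕ) • z ≠ 0 → 1 ≤ z.val ∧ z.val < n ∧ z.val ≠ n / 2 := by
    intro z hz
    rw [Ne, two_smul_eq_zero_iff n hn2, not_or] at hz
    refine ⟨?_, ZMod.val_lt z, ?_⟩
    · rw [Nat.one_le_iff_ne_zero, Ne, ZMod.val_eq_zero]; exact hz.1
    · intro h; apply hz.2; rw [← h, ZMod.natCast_zmod_val]
  refine RData.of_rosa n hn2 (Fin (n / 2 - 1))
    (fun l => ((rosaX ((n / 2 : ℕ) : ℤ) k ((l.1 : ℤ) + 1) : ℤ) : ZMod n))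
    (fun l => ((rosaX ((n / 2 : ℕ) : ℤ) k ((l.1 : ℤ) + 1) + ((l.1 : ℤ) + 1) : ℤ) : ZMod n))
    (by rw [Fintype.card_fin]; omega) ?_ ?_
  · intro z hz
    obtain ⟨v1, v2, v3⟩ := hval z hz
    obtain ⟨d, d1, d2, hd⟩ := rosaX_cover (n : ℤ) ((n / 2 : ℕ) : ℤ) (k : ℤ) (z.val : ℤ)
      (by omega) (by omega) (by omega) (by omega) (by omega) (by omega)
    refine ⟨⟨(d - 1).toNat, by omega⟩, ?_⟩
    have hd' : (((d - 1).toNat : ℕ) : ℤ) + 1 = d := by omega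
    have e1 : (((z.val : ℕ) : ℤ) : ZMod n) = z := by simp
    have e2 : (((z.val : ℤ) - (n : ℤ) : ℤ) : ZMod n) = z := by simp
    simp only [hd']
    rcases hd with h | h | h | h
    · left; rw [h, e1]
    · left; rw [h, e2]
    · right; rw [h, e1]
    · right; rw [h, e2]
  · intro z hz
    obtain ⟨v1, v2, v3⟩ := hval z hz
    have e1 : ((z.val : ℕ) : ZMod n) = z := by simp
    by_cases c : z.val < n / 2
    · refine ⟨⟨z.val - 1, by omega⟩, Or.inl ?_⟩
      have : ((z.val - 1 : ℕ) : ℤ) + 1 = (z.val : ℤ) := by omega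
      simp only [this]
      push_cast
      rw [e1]; ring
    · refine ⟨⟨n - z.val - 1, by omega⟩, Or.inr ?_⟩
      have : ((n - z.val - 1 : ℕ) : ℤ) + 1 = (n : ℤ) - (z.val : ℤ) := by omega
      simp only [this]
      push_cast
      rw [e1]; simp

lemma rdata_8 : RData 8 :=
  RData.of_rosa 8 (by decide) (Fin 3) ![1, 5, 3] ![2, 7, 6] (by decide) (by decide) (by decide)

lemma rdata_10 : RData 10 :=
  RData.of_rosa 10 (by decide) (Fin 4) ![2, 6, 9, 8] ![4, 7, 3, 1] (by decide) (by decide)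
    (by decide)

lemma rdata (n : ℕ) (hn : n % 8 = 0 ∨ n % 8 = 2) (hn8 : 8 ≤ n) : RData n := by
  by_cases h8 : n = 8
  · subst h8; exact rdata_8
  by_cases h10 : n = 10
  · subst h10; exact rdata_10
  exact rdata_general n (n / 8) (by omega) (by omega)

/-- Triangle. -/
lemma cov_triangle (n : ℕ) (h : RData n) :
    Cov n (Finset.univ.filter fun t : Fin 3 × Fin 3 => t.1 ≠ t.2) := by
  obtain ⟨ι, _, X, Y, hc, hz⟩ := h
  refine ⟨ι × Bool, inferInstance, fun l => bif l.2 then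
      ![(0, 0), (1, Y l.1 - X l.1), (2, Y l.1)]
    else ![(0, 0), (1, X l.1 - Y l.1), (2, -Y l.1)], ?_, ?_⟩
  · rw [card_offdiag3, Fintype.card_prod, Fintype.card_bool]; omega
  · have key : ∀ (i j : Fin 3) z, i < j → (2 : ℕ) • z ≠ 0 → ∃ (k : ι × Bool) (a b : Fin 3), a ≠ b ∧
        ((bif k.2 then ![(0, 0), (1, Y k.1 - X k.1), (2, Y k.1)]
          else ![(0, 0), (1, X k.1 - Y k.1), (2, -Y k.1)] : Fin 3 → Fin 3 × ZMod n) a).1 = i ∧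
        ((bif k.2 then ![(0, 0), (1, Y k.1 - X k.1), (2, Y k.1)]
          else ![(0, 0), (1, X k.1 - Y k.1), (2, -Y k.1)] : Fin 3 → Fin 3 × ZMod n) b).1 = j ∧
        ((bif k.2 then ![(0, 0), (1, Y k.1 - X k.1), (2, Y k.1)]
          else ![(0, 0), (1, X k.1 - Y k.1), (2, -Y k.1)] : Fin 3 → Fin 3 × ZMod n) a).2 -
        ((bif k.2 then ![(0, 0), (1, Y k.1 - X k.1), (2, Y k.1)]
          else ![(0, 0), (1, X k.1 - Y k.1), (2, -Y k.1)] : Fin 3 → Fin 3 × ZMod n) b).2 = z := by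
      intro i j z hij hz0
      obtain ⟨-, ⟨l1, h1⟩, ⟨l2, h2⟩, ⟨l3, h3⟩⟩ := hz z hz0
      fin_cases i <;> fin_cases j <;> simp at hij
      · rcases h1 with h1 | h1
        · exact ⟨(l1, false), 0, 1, by decide, rfl, rfl, by simp [← h1]⟩
        · exact ⟨(l1, true), 0, 1, by decide, rfl, rfl, by simp [← h1]⟩
      · rcases h3 with h1 | h1
        · exact ⟨(l3, false), 0, 2, by decide, rfl, rfl, by simp [← h1]⟩
        · exact ⟨(l3, true), 0, 2, by decide, rfl, rfl, by simp [← h1]⟩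
      · rcases h2 with h1 | h1
        · exact ⟨(l2, false), 1, 2, by decide, rfl, rfl, by simp [← h1]⟩
        · exact ⟨(l2, true), 1, 2, by decide, rfl, rfl, by simp [← h1]⟩
    intro i j z hij hz0
    rcases lt_or_gt_of_ne (Finset.mem_filter.1 hij).2 with h | h
    · exact key i j z h hz0
    · obtain ⟨k, a, b, hab, e1, e2, e3⟩ := key j i (-z) h (by rwa [smul_neg, neg_ne_zero])
      exact ⟨k, b, a, hab.symm, e2, e1, by rw [← neg_sub, e3, neg_neg]⟩

/-- Lollipop. -/
lemma cov_lollipop (n : ℕ) (h : RData n) :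
    Cov n ({(0, 0), (0, 1), (1, 0)} : Finset (Fin 2 × Fin 2)) := by
  obtain ⟨ι, _, X, Y, hc, hz⟩ := h
  refine ⟨ι, inferInstance, fun l => ![(0, X l), (0, Y l), (1, 0)], ?_, ?_⟩
  · have : ({(0, 0), (0, 1), (1, 0)} : Finset (Fin 2 × Fin 2)).card = 3 := by decide
    rw [this]; omega
  · intro i j z hij hz0
    obtain ⟨-, ⟨l1, h1⟩, -, -⟩ := hz z hz0
    obtain ⟨⟨l2, h2⟩, -, -, -⟩ := hz z hz0
    obtain ⟨⟨l3, h3⟩, -, -, -⟩ := hz (-z) (by rwa [smul_neg, neg_ne_zero])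
    simp only [Finset.mem_insert, Finset.mem_singleton, Prod.mk.injEq] at hij
    rcases hij with ⟨rfl, rfl⟩ | ⟨rfl, rfl⟩ | ⟨rfl, rfl⟩
    · rcases h1 with h1 | h1
      · exact ⟨l1, 1, 0, by decide, rfl, rfl, by simp [← h1]⟩
      · exact ⟨l1, 0, 1, by decide, rfl, rfl, by simp [← h1]⟩
    · rcases h2 with h1 | h1
      · exact ⟨l2, 0, 2, by decide, rfl, rfl, by simp [← h1]⟩
      · exact ⟨l2, 1, 2, by decide, rfl, rfl, by simp [← h1]⟩
    · rcases h3 with h1 | h1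
      · exact ⟨l3, 2, 0, by decide, rfl, rfl, by simp [h1]⟩
      · exact ⟨l3, 2, 1, by decide, rfl, rfl, by simp [h1]⟩

/-- Blocks of the code with three rows and two infinite rows. -/
def pentBlock {n : ℕ} {ι : Type} (X Y : ι → ZMod n) (t : ι × Fin 7) : Fin 3 → Fin 5 × ZMod n :=
  (![![(0, 0), (1, Y t.1 - X t.1), (2, Y t.1)],
    ![(3, 0), (0, X t.1), (0, Y t.1)],
    ![(3, 0), (1, X t.1), (1, Y t.1)],
    ![(3, 0), (2, X t.1), (2, Y t.1)],
    ![(4, 0), (0, -X t.1), (1, -Y t.1)],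
    ![(4, 0), (2, Y t.1 - X t.1), (1, Y t.1)],
    ![(4, 0), (2, X t.1 - Y t.1), (0, X t.1)]] : Fin 7 → Fin 3 → Fin 5 × ZMod n) t.2

lemma cov_pent (n : ℕ) (h : RData n) :
    Cov n (Finset.univ.filter fun t : Fin 5 × Fin 5 => ¬ (3 ≤ t.1 ∧ 3 ≤ t.2)) := by
  obtain ⟨ι, _, X, Y, hc, hz⟩ := h
  refine ⟨ι × Fin 7, inferInstance, pentBlock X Y, ?_, ?_⟩
  · have : (Finset.univ.filter fun t : Fin 5 × Fin 5 => ¬ (3 ≤ t.1 ∧ 3 ≤ t.2)).card = 21 := by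
      decide
    rw [this, Fintype.card_prod, Fintype.card_fin]; omega
  · have key : ∀ (i j : Fin 5) z, i ≤ j → ¬ (3 ≤ i ∧ 3 ≤ j) → (2 : ℕ) • z ≠ 0 →
        ∃ (k : ι × Fin 7) (a b : Fin 3), a ≠ b ∧ (pentBlock X Y k a).1 = i ∧
          (pentBlock X Y k b).1 = j ∧ (pentBlock X Y k a).2 - (pentBlock X Y k b).2 = z := by
      intro i j z hij hR hz0
      obtain ⟨⟨l0, h0⟩, ⟨l1, h1⟩, ⟨l2, h2⟩, ⟨l3, h3⟩⟩ := hz z hz0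
      fin_cases i <;> fin_cases j <;> simp at hij hR
      -- (0,0)
      · rcases h1 with h1 | h1
        · exact ⟨(l1, 1), 2, 1, by decide, rfl, rfl, by simp [pentBlock, ← h1]⟩
        · exact ⟨(l1, 1), 1, 2, by decide, rfl, rfl, by simp [pentBlock, ← h1]⟩
      -- (0,1)
      · rcases h1 with h1 | h1
        · exact ⟨(l1, 4), 1, 2, by decide, rfl, rfl, by simp [pentBlock, ← h1]; ring⟩
        · exact ⟨(l1, 0), 0, 1, by decide, rfl, rfl, by simp [pentBlock, ← h1]⟩
      -- (0,2)
      · rcases h3 with h1 | h1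
        · exact ⟨(l3, 6), 2, 1, by decide, rfl, rfl, by simp [pentBlock, ← h1]⟩
        · exact ⟨(l3, 0), 0, 2, by decide, rfl, rfl, by simp [pentBlock, ← h1]⟩
      -- (0,3)
      · rcases h0 with h1 | h1
        · exact ⟨(l0, 1), 1, 0, by decide, rfl, rfl, by simp [pentBlock, ← h1]⟩
        · exact ⟨(l0, 1), 2, 0, by decide, rfl, rfl, by simp [pentBlock, ← h1]⟩
      -- (0,4)
      · rcases h2 with h1 | h1
        · exact ⟨(l2, 6), 2, 0, by decide, rfl, rfl, by simp [pentBlock, ← h1]⟩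
        · exact ⟨(l2, 4), 1, 0, by decide, rfl, rfl, by simp [pentBlock, ← h1]⟩
      -- (1,1)
      · rcases h1 with h1 | h1
        · exact ⟨(l1, 2), 2, 1, by decide, rfl, rfl, by simp [pentBlock, ← h1]⟩
        · exact ⟨(l1, 2), 1, 2, by decide, rfl, rfl, by simp [pentBlock, ← h1]⟩
      -- (1,2)
      · rcases h2 with h1 | h1
        · exact ⟨(l2, 5), 2, 1, by decide, rfl, rfl, by simp [pentBlock, ← h1]⟩
        · exact ⟨(l2, 0), 1, 2, by decide, rfl, rfl, by simp [pentBlock, ← h1]⟩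
      -- (1,3)
      · rcases h0 with h1 | h1
        · exact ⟨(l0, 2), 1, 0, by decide, rfl, rfl, by simp [pentBlock, ← h1]⟩
        · exact ⟨(l0, 2), 2, 0, by decide, rfl, rfl, by simp [pentBlock, ← h1]⟩
      -- (1,4)
      · rcases h3 with h1 | h1
        · exact ⟨(l3, 5), 2, 0, by decide, rfl, rfl, by simp [pentBlock, ← h1]⟩
        · exact ⟨(l3, 4), 2, 0, by decide, rfl, rfl, by simp [pentBlock, ← h1]⟩
      -- (2,2)
      · rcases h1 with h1 | h1
        · exact ⟨(l1, 3), 2, 1, by decide, rfl, rfl, by simp [pentBlock, ← h1]⟩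
        · exact ⟨(l1, 3), 1, 2, by decide, rfl, rfl, by simp [pentBlock, ← h1]⟩
      -- (2,3)
      · rcases h0 with h1 | h1
        · exact ⟨(l0, 3), 1, 0, by decide, rfl, rfl, by simp [pentBlock, ← h1]⟩
        · exact ⟨(l0, 3), 2, 0, by decide, rfl, rfl, by simp [pentBlock, ← h1]⟩
      -- (2,4)
      · rcases h1 with h1 | h1
        · exact ⟨(l1, 5), 1, 0, by decide, rfl, rfl, by simp [pentBlock, ← h1]⟩
        · exact ⟨(l1, 6), 1, 0, by decide, rfl, rfl, by simp [pentBlock, ← h1]⟩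
    intro i j z hij hz0
    have hR := (Finset.mem_filter.1 hij).2
    rcases le_total i j with h | h
    · exact key i j z h hR hz0
    · obtain ⟨k, a, b, hab, e1, e2, e3⟩ := key j i (-z) h (fun h => hR ⟨h.2, h.1⟩)
        (by rwa [smul_neg, neg_ne_zero])
      exact ⟨k, b, a, hab.symm, e2, e1, by rw [← neg_sub, e3, neg_neg]⟩

lemma cov_tri (n : ℕ) (h : RData n) {α : Type} [DecidableEq α] (i j k : α) (hij : i ≠ j)
    (hik : i ≠ k) (hjk : j ≠ k) :
    Cov n ({(i, j), (j, i), (i, k), (k, i), (j, k), (k, j)} : Finset (α × α)) := by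
  have hinj : Function.Injective ![i, j, k] := by
    intro a b hab
    fin_cases a <;> fin_cases b <;> simp_all
  have := (cov_triangle n h).map ![i, j, k] hinj
  convert this using 1
  have e : (Finset.univ.filter fun t : Fin 3 × Fin 3 => t.1 ≠ t.2) =
    {(0, 1), (1, 0), (0, 2), (2, 0), (1, 2), (2, 1)} := by decide
  rw [e]
  simp [Finset.image_insert, Finset.image_singleton]

lemma cov_lol (n : ℕ) (h : RData n) {α : Type} [DecidableEq α] (i j : α) (hij : i ≠ j) :
    Cov n ({(i, i), (i, j), (j, i)} : Finset (α × α)) := by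
  have hinj : Function.Injective ![i, j] := by
    intro a b hab
    fin_cases a <;> fin_cases b <;> simp_all
  have := (cov_lollipop n h).map ![i, j] hinj
  convert this using 1
  simp [Finset.image_insert, Finset.image_singleton]

lemma cov_of_ts (n : ℕ) (h : RData n) {α : Type} [DecidableEq α] (E : Finset (α × α))
    (f : α → α → α) (hs : ∀ i j, (i, j) ∈ E → (j, i) ∈ E)
    (hcl : ∀ i j, (i, j) ∈ E → (i, f i j) ∈ E)
    (hcomm : ∀ i j, (i, j) ∈ E → f i j = f j i)
    (hinv : ∀ i j, (i, j) ∈ E → f i (f i j) = j)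
    (hid : ∀ i, (i, i) ∈ E → f i i ≠ i) : Cov n E := by
  let g : α × α → Finset α := fun t => {t.1, t.2, f t.1 t.2}
  have lol : ∀ i, (i, i) ∈ E → Cov n (E.filter fun t => g t = g (i, i)) := by
    intro i hi
    obtain ⟨k, hk⟩ : ∃ k, f i i = k := ⟨_, rfl⟩
    have hne : i ≠ k := fun h => hid i hi (hk.trans h.symm)
    have m1 : (i, k) ∈ E := hk ▸ hcl i i hi
    have m2 : (k, i) ∈ E := hs _ _ m1
    have f1 : f i k = i := by have := hinv i i hi; rwa [hk] at this
    have f2 : f k i = i := by rw [← hcomm i k m1, f1]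
    convert cov_lol n h i k hne using 1
    ext ⟨a, b⟩
    simp only [Finset.mem_filter, g, Finset.mem_insert, Finset.mem_singleton, Prod.mk.injEq, hk]
    constructor
    · rintro ⟨hab, he⟩
      have ha : a = i ∨ a = k := by
        have : a ∈ ({i, i, k} : Finset α) := by rw [← he]; simp
        simpa using this
      have hb : b = i ∨ b = k := by
        have : b ∈ ({i, i, k} : Finset α) := by rw [← he]; simp
        simpa using this
      rcases ha with rfl | rfl <;> rcases hb with rfl | rfl
      · simp
      · simp
      · simp
      · exfalso
        have : i ∈ ({b, b, f b b} : Finset α) := by rw [he]; simp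
        simp only [Finset.mem_insert, Finset.mem_singleton] at this
        have hi' : i = f b b := by tauto
        have h3 := hinv b b hab
        rw [← hi', f2] at h3
        exact hne h3
    · rintro (⟨rfl, rfl⟩ | ⟨rfl, rfl⟩ | ⟨rfl, rfl⟩)
      · exact ⟨hi, by rw [hk]⟩
      · refine ⟨m1, ?_⟩
        rw [f1]; ext x; simp; tauto
      · refine ⟨m2, ?_⟩
        rw [f2]; ext x; simp; tauto
  refine Cov.glue (E.image g) (fun b => E.filter fun t => g t = b) ?_ E ?_ ?_
  · intro b hb
    obtain ⟨⟨i, j⟩, hij, rfl⟩ := Finset.mem_image.1 hb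
    obtain ⟨k, hk⟩ : ∃ k, f i j = k := ⟨_, rfl⟩
    have m1 := hs _ _ hij
    have m2 : (i, k) ∈ E := hk ▸ hcl i j hij
    have m3 := hs _ _ m2
    have hk' : f j i = k := by rw [← hcomm i j hij, hk]
    have m4 : (j, k) ∈ E := hk' ▸ hcl j i m1
    have m5 := hs _ _ m4
    have f1 : f i k = j := hk ▸ hinv i j hij
    have f2 : f k i = j := by rw [← hcomm i k m2, f1]
    have f3 : f j k = i := hk' ▸ hinv j i m1
    have f4 : f k j = i := by rw [← hcomm j k m4, f3]
    by_cases e1 : i = j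
    · subst e1; exact lol i hij
    by_cases e2 : i = k
    · subst e2
      have : g (i, j) = g (i, i) := by
        simp only [g, hk, f1]; ext x; simp; tauto
      rw [this]; exact lol i m2
    by_cases e3 : j = k
    · subst e3
      have : g (i, j) = g (j, j) := by
        simp only [g, hk, f3]; ext x; simp; tauto
      rw [this]; exact lol j m4
    convert cov_tri n h i j k e1 e2 e3 using 1
    ext ⟨a, b⟩
    simp only [Finset.mem_filter, g, Finset.mem_insert, Finset.mem_singleton, Prod.mk.injEq, hk]
    constructor
    · rintro ⟨hab, he⟩
      have ha : a = i ∨ a = j ∨ a = k := by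
        have : a ∈ ({i, j, k} : Finset α) := by rw [← he]; simp
        simpa using this
      have hb : b = i ∨ b = j ∨ b = k := by
        have : b ∈ ({i, j, k} : Finset α) := by rw [← he]; simp
        simpa using this
      have hne : a ≠ b := by
        rintro rfl
        have c1 : ({i, j, k} : Finset α).card = 3 := Finset.card_eq_three.2
          ⟨i, j, k, e1, e2, e3, rfl⟩
        rw [← he, Finset.insert_eq_of_mem (by simp)] at c1
        have := Finset.card_le_two (a := a) (b := f a a)
        omega
      rcases ha with rfl | rfl | rfl <;> rcases hb with rfl | rfl | rfl <;> simp_all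
    · rintro (⟨rfl, rfl⟩ | ⟨rfl, rfl⟩ | ⟨rfl, rfl⟩ | ⟨rfl, rfl⟩ | ⟨rfl, rfl⟩ | ⟨rfl, rfl⟩)
      · exact ⟨hij, by rw [hk]⟩
      · refine ⟨m1, ?_⟩
        rw [hk']; ext x; simp; tauto
      · refine ⟨m2, ?_⟩
        rw [f1]; ext x; simp; tauto
      · refine ⟨m3, ?_⟩
        rw [f2]; ext x; simp; tauto
      · refine ⟨m4, ?_⟩
        rw [f3]; ext x; simp; tauto
      · refine ⟨m5, ?_⟩
        rw [f4]; ext x; simp; tauto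
  · intro x hx
    exact ⟨g x, Finset.mem_image_of_mem _ hx, Finset.mem_filter.2 ⟨hx, rfl⟩⟩
  · rw [← Finset.card_eq_sum_card_image]

/-- Bose-type construction from a holey commutative quasigroup. -/
lemma cov_bose (n : ℕ) (h : RData n) {Q T : Type} [Fintype Q] [DecidableEq Q] [DecidableEq T]
    (fib : Q → T) (op : Q → Q → Q) (hcomm : ∀ p q, fib p ≠ fib q → op p q = op q p)
    (hfib : ∀ p q, fib p ≠ fib q → fib (op p q) ≠ fib p)
    (hinj : ∀ p q q', fib p ≠ fib q → fib p ≠ fib q' → op p q = op p q' → q = q') :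
    Cov n (Finset.univ.filter fun t : (Q × ZMod 3) × (Q × ZMod 3) =>
      fib t.1.1 ≠ fib t.2.1) := by
  classical
  have hdiv : ∀ p q, ∃ y, fib p ≠ fib q → (fib p ≠ fib y ∧ op p y = q) := by
    intro p q
    by_cases hpq : fib p ≠ fib q
    · let S := Finset.univ.filter fun q => fib p ≠ fib q
      have himg : S.image (op p) = S := by
        apply Finset.eq_of_subset_of_card_le
        · intro x hx
          obtain ⟨y, hy, rfl⟩ := Finset.mem_image.1 hx
          exact Finset.mem_filter.2 ⟨Finset.mem_univ _,
            (hfib p y (Finset.mem_filter.1 hy).2).symm⟩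
        · rw [Finset.card_image_of_injOn]
          intro x hx y hy hxy
          exact hinj p x y (Finset.mem_filter.1 hx).2 (Finset.mem_filter.1 hy).2 hxy
      have : q ∈ S.image (op p) := by rw [himg]; simp [S, hpq]
      obtain ⟨y, hy, hyq⟩ := Finset.mem_image.1 this
      exact ⟨y, fun _ => ⟨(Finset.mem_filter.1 hy).2, hyq⟩⟩
    · exact ⟨p, fun h => absurd h hpq⟩
  choose dv hdv using hdiv
  have hdvop : ∀ p q, fib p ≠ fib q → dv p (op p q) = q := by
    intro p q hpq
    have h1 := hdv p (op p q) (hfib p q hpq).symm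
    exact hinj p _ q h1.1 hpq h1.2
  have hfib2 : ∀ p q, fib p ≠ fib q → fib (op p q) ≠ fib q := by
    intro p q hpq; rw [hcomm p q hpq]; exact hfib q p hpq.symm
  have hdvfib : ∀ p q, fib p ≠ fib q → fib (dv p q) ≠ fib q := by
    intro p q hpq
    have h1 := hdv p q hpq
    have := hfib2 p _ h1.1
    rw [h1.2] at this; exact this.symm
  let f : Q × ZMod 3 → Q × ZMod 3 → Q × ZMod 3 := fun u v =>
    if u.2 = v.2 then (op u.1 v.1, u.2 + 1)
    else if v.2 = u.2 + 1 then (dv u.1 v.1, u.2) else (dv v.1 u.1, v.2)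
  have hz3 : ∀ a b : ZMod 3, a ≠ b → b ≠ a + 1 → a = b + 1 := by decide
  have hz3a : ∀ a : ZMod 3, a ≠ a + 1 := by decide
  have hz3b : ∀ a : ZMod 3, a ≠ a + 1 + 1 := by decide
  refine cov_of_ts n h _ f ?_ ?_ ?_ ?_ ?_
  · rintro ⟨p, a⟩ ⟨q, b⟩ hpq
    simp only [Finset.mem_filter, Finset.mem_univ, true_and] at hpq ⊢
    exact hpq.symm
  · rintro ⟨p, a⟩ ⟨q, b⟩ hpq
    simp only [Finset.mem_filter, Finset.mem_univ, true_and, f] at hpq ⊢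
    split_ifs
    · exact (hfib p q hpq).symm
    · exact (hdv p q hpq).1
    · exact (hdvfib q p hpq.symm).symm
  · rintro ⟨p, a⟩ ⟨q, b⟩ hpq
    simp only [Finset.mem_filter, Finset.mem_univ, true_and, f] at hpq ⊢
    by_cases e1 : a = b
    · subst e1; simp [hcomm p q hpq]
    · by_cases e2 : b = a + 1
      · subst e2; simp [hz3a, hz3b]
      · have := hz3 a b e1 e2
        subst this; simp [hz3a, hz3b]
  · rintro ⟨p, a⟩ ⟨q, b⟩ hpq
    simp only [Finset.mem_filter, Finset.mem_univ, true_and, f] at hpq ⊢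
    by_cases e1 : a = b
    · subst e1; simp [hdvop p q hpq]
    · by_cases e2 : b = a + 1
      · subst e2; simp [(hdv p q hpq).2]
      · have := hz3 a b e1 e2
        subst this
        have h1 := hdv q p hpq.symm
        have h2 : dv (dv q p) p = q := by
          have h3 : op (dv q p) q = p := by rw [hcomm _ _ h1.1.symm, h1.2]
          have := hdvop (dv q p) q h1.1.symm
          rwa [h3] at this
        simp [hz3b, h2]
  · rintro ⟨p, a⟩ hpq
    simp at hpq

set_option linter.all false

/-- Commutative holey quasigroup operation, odd number of groups. -/
def opOdd {K : Type} [CommRing K] (c : K) (p q : K × (Bool × ZMod 2)) : K × (Bool × ZMod 2) :=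
  (c * (p.1 + q.1), (xor p.2.1 q.2.1, p.2.2 + q.2.2))

/-- Commutative holey quasigroup operation, even number of groups. -/
def opEven {K : Type} [CommRing K] [DecidableEq K] (c : K) :
    Option K × (Bool × ZMod 2) → Option K × (Bool × ZMod 2) → Option K × (Bool × ZMod 2)
  | (none, _), (none, b) => (none, b)
  | (none, (e, l)), (some x, (h, k)) => (some (if e = h then x + c else x - c), (!h, k + l))
  | (some x, (h, k)), (none, (e, l)) => (some (if e = h then x + c else x - c), (!h, k + l))
  | (some x, (h, k)), (some y, (h', k')) =>
    if y = x + 1 then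
      if h = h' then (some (x + c), (h, k + k')) else (none, (h, k + k'))
    else if x = y + 1 then
      if h = h' then (some (y + c), (h, k + k')) else (none, (h', k + k'))
    else (some (c * (x + y)), (xor h h', k + k'))

lemma cov_odd (n : ℕ) (h : RData n) {K : Type} [CommRing K] [Fintype K] [DecidableEq K] (c : K)
    (hc : 2 * c = 1) :
    Cov n (Finset.univ.filter fun t : ((K × (Bool × ZMod 2)) × ZMod 3) ×
      ((K × (Bool × ZMod 2)) × ZMod 3) => t.1.1.1 ≠ t.2.1.1) := by
  refine cov_bose n h (fun q : K × (Bool × ZMod 2) => q.1) (opOdd c) ?_ ?_ ?_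
  · rintro ⟨x, e, k⟩ ⟨y, e', k'⟩ -
    simp only [opOdd, add_comm x y, add_comm k k', Bool.xor_comm e e']
  · rintro ⟨x, e, k⟩ ⟨y, e', k'⟩ hxy
    simp only [opOdd] at hxy ⊢
    intro h1
    exact hxy (by linear_combination (-2 : K) * h1 + (x + y) * hc)
  · rintro ⟨x, e, k⟩ ⟨y, e', k'⟩ ⟨y', e'', k''⟩ h1 h2 heq
    simp only [opOdd, Prod.mk.injEq] at heq
    obtain ⟨h3, h4, h5⟩ := heq
    have a1 : y = y' := by linear_combination 2 * h3 - (y - y') * hc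
    have a2 : e' = e'' := by revert h4; cases e <;> cases e' <;> cases e'' <;> simp
    have a3 : k' = k'' := by simpa using h5
    rw [a1, a2, a3]

lemma cov_even (n : ℕ) (h : RData n) {K : Type} [CommRing K] [Nontrivial K] [Fintype K]
    [DecidableEq K] (c : K) (hc : 2 * c = 1) :
    Cov n (Finset.univ.filter fun t : ((Option K × (Bool × ZMod 2)) × ZMod 3) ×
      ((Option K × (Bool × ZMod 2)) × ZMod 3) => t.1.1.1 ≠ t.2.1.1) := by
  have one : (1 : K) ≠ 0 := one_ne_zero
  have c0 : c ≠ 0 := by rintro rfl; simp at hc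
  have t0 : (2 : K) ≠ 0 := by intro h; rw [h] at hc; simp at hc
  have h11 : ∀ x y : K, y = x + 1 → x ≠ y + 1 := fun x y h h' =>
    t0 (by linear_combination -h - h')
  have E1 : ∀ x y : K, x + c = y - c → y = x + 1 := fun x y h => by linear_combination -h + hc
  have E3 : ∀ x y : K, c * (x + y) = x → x = y := fun x y h1 => by
    linear_combination -(2 : K) * h1 + (x + y) * hc
  have E4 : ∀ x y : K, c * (x + y) = x + c → y = x + 1 := fun x y h1 => by
    linear_combination (2 : K) * h1 - (x + y - 1) * hc
  have E5 : ∀ x y : K, c * (x + y) = x - c → x = y + 1 := fun x y h1 => by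
    linear_combination -(2 : K) * h1 + (x + y + 1) * hc
  have E6 : ∀ x y y' : K, c * (x + y) = c * (x + y') → y = y' := fun x y y' h1 => by
    linear_combination (2 : K) * h1 - (y - y') * hc
  have E7 : ∀ x : K, x + 1 - c = x + c := fun x => by linear_combination -hc
  refine cov_bose n h (fun q : Option K × (Bool × ZMod 2) => q.1) (opEven c) ?_ ?_ ?_
  · rintro ⟨_ | x, e, k⟩ ⟨_ | y, e', k'⟩ hxy <;> simp only [opEven] at hxy ⊢
    · simp at hxy
    · rw [add_comm k k', add_comm x y, Bool.xor_comm e e']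
      by_cases h1 : y = x + 1
      · rw [if_pos h1, if_neg (h11 x y h1), if_pos h1]
        cases e <;> cases e' <;> rfl
      · rw [if_neg h1, if_neg h1]
        cases e <;> cases e' <;> rfl
  · rintro ⟨_ | x, e, k⟩ ⟨_ | y, e', k'⟩ hxy <;> simp only [opEven] at hxy ⊢
    · simp at hxy
    · simp
    · split_ifs
      · simpa using c0
      · simpa using c0
    · have hxy' : x ≠ y := fun h => hxy (congrArg some h)
      split_ifs with h1 h2 h3 h4
      · simpa using c0
      · simp
      · intro h5
        have h5 := Option.some.inj h5
        exact c0 (by linear_combination -h5 - h3 + hc)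
      · simp
      · intro h5
        exact hxy' (E3 x y (Option.some.inj h5))
  · rintro ⟨_ | x, e, k⟩ ⟨_ | y, e', k'⟩ ⟨_ | y', e'', k''⟩ h1 h2 heq <;>
      simp only [opEven] at h1 h2 heq ⊢
    · simp at h1
    · simp at h1
    · simp at h2
    · simp only [Prod.mk.injEq, Option.some.injEq] at heq
      obtain ⟨g1, g2, g3⟩ := heq
      have g2 : e' = e'' := by simpa using g2
      have g3 : k' = k'' := by simpa using g3
      subst g2 g3
      split_ifs at g1
      · simpa using g1
      · simpa using g1
    · simp only [Prod.mk.injEq, Option.some.injEq] at heq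
      obtain ⟨g1, g2, g3⟩ := heq
      have g3 : k' = k'' := by simpa using g3
      subst g3
      have : e' = e'' := by
        have hcc : x + c ≠ x - c := fun h => one (by linear_combination h - hc)
        split_ifs at g1 with i1 i2 i3
        · exact i1.trans i2.symm
        · exact absurd g1 hcc
        · exact absurd g1.symm hcc
        · revert i1 i3; cases e <;> cases e' <;> cases e'' <;> simp
      rw [this]
    · exfalso
      split_ifs at heq <;> simp only [Prod.mk.injEq, Option.some.injEq] at heq <;> grind
    · exfalso
      split_ifs at heq <;> simp only [Prod.mk.injEq, Option.some.injEq] at heq <;> grind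
    · have hk : k' = k'' := by
        have := congrArg (fun t => t.2.2) heq
        split_ifs at this <;> simpa using this
      subst hk
      have : y = y' ∧ e' = e'' := by
        clear h h1 h2
        cases e <;> cases e' <;> cases e'' <;>
        simp only [Bool.false_eq_true, Bool.true_eq_false, if_true, if_false, reduceCtorEq] at heq <;>
        split_ifs at heq <;>
        simp only [Prod.mk.injEq, Option.some.injEq, Bool.xor_false, Bool.xor_true, and_true,
          Bool.not_false, Bool.not_true, reduceCtorEq, and_false, false_and] at heq <;>
        first
        | contradiction
        | grind
      rw [this.1, this.2]


lemma cov_transport (n t : ℕ) {G : Type} [Fintype G] [DecidableEq G] (hG : Fintype.card G = t)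
    (h : Cov n (Finset.univ.filter fun u : ((G × (Bool × ZMod 2)) × ZMod 3) ×
      ((G × (Bool × ZMod 2)) × ZMod 3) => u.1.1.1 ≠ u.2.1.1)) :
    Cov n (Finset.univ.filter fun u : (Fin t × Fin 12) × (Fin t × Fin 12) => u.1.1 ≠ u.2.1) := by
  let eG : G ≃ Fin t := Fintype.equivFinOfCardEq hG
  let eB : (Bool × ZMod 2) × ZMod 3 ≃ Fin 12 := Fintype.equivFinOfCardEq (by decide)
  let φ : (G × (Bool × ZMod 2)) × ZMod 3 ≃ Fin t × Fin 12 :=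
    (Equiv.prodAssoc _ _ _).trans (Equiv.prodCongr eG eB)
  have hφ : ∀ u, (φ u).1 = eG u.1.1 := fun u => rfl
  convert h.map φ φ.injective using 1
  ext ⟨a, b⟩
  simp only [Finset.mem_filter, Finset.mem_univ, true_and, Finset.mem_image, Prod.exists,
    Prod.map_apply, Prod.mk.injEq]
  constructor
  · intro hab
    obtain ⟨⟨⟨g, c⟩, d⟩, rfl⟩ := φ.surjective a
    obtain ⟨⟨⟨g', c'⟩, d'⟩, rfl⟩ := φ.surjective b
    refine ⟨g, c.1, c.2, d, g', c'.1, c'.2, d', ?_, rfl, rfl⟩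
    rintro rfl
    exact hab rfl
  · rintro ⟨g, c1, c2, d, g', c1', c2', d', hne, rfl, rfl⟩
    rw [hφ, hφ]
    exact fun h => hne (eG.injective h)

lemma exists_half (s : ℕ) (hs : s % 2 = 1) : ∃ c : ZMod s, 2 * c = 1 := by
  refine ⟨((s / 2 + 1 : ℕ) : ZMod s), ?_⟩
  have : (2 * (s / 2 + 1) : ℕ) = s + 1 := by omega
  have h2 := congrArg (fun a : ℕ => (a : ZMod s)) this
  simpa using h2

lemma cov_gdd (n : ℕ) (h : RData n) (t : ℕ) (ht : 3 ≤ t) :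
    Cov n (Finset.univ.filter fun u : (Fin t × Fin 12) × (Fin t × Fin 12) => u.1.1 ≠ u.2.1) := by
  rcases Nat.even_or_odd t with he | ho
  · have hs : (t - 1) % 2 = 1 := by obtain ⟨k, hk⟩ := he; omega
    obtain ⟨c, hc⟩ := exists_half (t - 1) hs
    haveI : NeZero (t - 1) := ⟨by omega⟩
    haveI : Fact (1 < t - 1) := ⟨by omega⟩
    refine cov_transport n t (G := Option (ZMod (t - 1))) ?_ (cov_even n h c hc)
    rw [Fintype.card_option, ZMod.card]
    omega
  · obtain ⟨c, hc⟩ := exists_half t (Nat.odd_iff.1 ho)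
    haveI : NeZero t := ⟨by omega⟩
    exact cov_transport n t (G := ZMod t) (ZMod.card t) (cov_odd n h c hc)


/-- Entry `(i, j)` of an `m × m` table packed in base 64. -/
def tget (T m i j : ℕ) : ℕ := (T / 64 ^ (m * i + j)) % 64

/-- Check that a packed table is a totally symmetric partial quasigroup without idempotents. -/
def chk (T m : ℕ) (P : ℕ → ℕ → Bool) : Bool :=
  (List.range m).all fun i => (List.range m).all fun j =>
    !(P i j) || (P j i && Nat.blt (tget T m i j) m && P i (tget T m i j) &&
      Nat.beq (tget T m i j) (tget T m j i) && Nat.beq (tget T m i (tget T m i j)) j &&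
      !(Nat.beq i j && Nat.beq (tget T m i j) i))

/-- Pairs not inside the hole `{N, N+1, …}`. -/
def holeP (N i j : ℕ) : Bool := Nat.blt i N || Nat.blt j N

/-- Pairs handled by the four copies of the pentagon code. -/
def exclP (i j : ℕ) : Bool :=
  (Nat.blt i 12 && Nat.blt j 12 && Nat.beq (i / 3) (j / 3)) ||
  (Nat.blt i 12 && (Nat.beq j 12 || Nat.beq j 13)) ||
  (Nat.blt j 12 && (Nat.beq i 12 || Nat.beq i 13))

lemma cov_table (n : ℕ) (h : RData n) (T m : ℕ) (P : ℕ → ℕ → Bool) (hc : chk T m P = true) :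
    Cov n (Finset.univ.filter fun t : Fin m × Fin m => P t.1 t.2 = true) := by
  have key : ∀ i j : Fin m, P i j = true → P j i = true ∧ tget T m i j < m ∧
      P i (tget T m i j) = true ∧ tget T m i j = tget T m j i ∧
      tget T m i (tget T m i j) = j ∧ ¬ ((i : ℕ) = j ∧ tget T m i j = i) := by
    intro i j hij
    have h1 := List.all_eq_true.1 hc i (List.mem_range.2 i.2)
    have h2 := List.all_eq_true.1 h1 j (List.mem_range.2 j.2)
    rw [hij] at h2
    simp only [Bool.not_true, Bool.false_or, Bool.and_eq_true, Nat.blt_eq] at h2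
    obtain ⟨⟨⟨⟨⟨a, b⟩, c⟩, d⟩, e⟩, g⟩ := h2
    refine ⟨a, b, c, Nat.eq_of_beq_eq_true d, Nat.eq_of_beq_eq_true e, ?_⟩
    rintro ⟨g1, g2⟩
    rw [g2, g1, Nat.beq_refl] at g
    simp at g
  let f : Fin m → Fin m → Fin m := fun i j =>
    if hlt : tget T m i j < m then ⟨tget T m i j, hlt⟩ else i
  have hf : ∀ i j : Fin m, P i j = true → ((f i j : Fin m) : ℕ) = tget T m i j := by
    intro i j hij
    simp only [f]
    rw [dif_pos (key i j hij).2.1]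
  refine cov_of_ts n h _ f ?_ ?_ ?_ ?_ ?_
  · intro i j hij
    simp only [Finset.mem_filter, Finset.mem_univ, true_and] at hij ⊢
    exact (key i j hij).1
  · intro i j hij
    simp only [Finset.mem_filter, Finset.mem_univ, true_and] at hij ⊢
    rw [hf i j hij]
    exact (key i j hij).2.2.1
  · intro i j hij
    simp only [Finset.mem_filter, Finset.mem_univ, true_and] at hij ⊢
    apply Fin.ext
    rw [hf i j hij, hf j i (key i j hij).1]
    exact (key i j hij).2.2.2.1
  · intro i j hij
    simp only [Finset.mem_filter, Finset.mem_univ, true_and] at hij ⊢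
    apply Fin.ext
    have h3 : P i (f i j) = true := by rw [hf i j hij]; exact (key i j hij).2.2.1
    rw [hf i _ h3, hf i j hij]
    exact (key i j hij).2.2.2.2.1
  · intro i hij h4
    simp only [Finset.mem_filter, Finset.mem_univ, true_and] at hij
    have h5 := congrArg Fin.val h4
    rw [hf i i hij] at h5
    exact (key i i hij).2.2.2.2.2 ⟨rfl, h5⟩

/-- Packed table with 12 points outside a hole of size 1. -/
def tab12h1 : ℕ :=
  391217393016501461027974175012685413095118991940644482931905399495115400502190573508493558218509652327531988520002406874072950721715015010786630505574269600212729013353374093642501425162844940634162813600305923904609163771651452909347772488092114883062324969433905371805930993189461326796464762059276875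

lemma chk12h1 : chk tab12h1 13 (holeP 12) = true := by
  decide +kernel

/-- Packed table with 12 points outside a hole of size 2. -/
def tab12h2 : ℕ :=
  43685763899175298403928821408124939384487339772159802748339175914443000602364214241726746149566271713409767758705434228451766629554024796850485773423574520223369475479476524507741897664514995673531561529395086501427227905258082762134766136379625739387885791971298081222999721677078297953513529467584481306555809994658298074823303182799465179670953985

lemma chk12h2 : chk tab12h2 14 (holeP 12) = true := by
  decide +kernel

/-- Packed table with 12 points outside a hole of size 4. -/
def tab12h4 : ℕ :=
  9227968557441308554905824770693509272567875053857122523893903364912950688142771910019909250013340990677247700712472617079116977860217697574559160960824724363592292391387674358910973474419029638577564736751915328763721187827780164814617964198302516155130926400778896031928496789688773204430569324529736319194210245436821408548429717004304230352610417071591417644079552661497312177193572737539242373572411289243296143887371617743250875695541174603797283535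

lemma chk12h4 : chk tab12h4 16 (holeP 12) = true := by
  decide +kernel

/-- Packed table with 12 points outside a hole of size 5. -/
def tab12h5 : ℕ :=
  71344608742324200461684828985607512919123626072311496018902418477671403155697664228497000849154239495530217269907325001421000426782006746514759850953103387790537611967093429160883738873648391939027726667518410070756588021699497625030859668607877652577718939707025363234518403721248649954802142832612423322397728775685500207335363553001768243474609041295346476869598235723917150905952808078673051346551437752087156950836448639034064368517188630783704813645104190158856211512102455826115573206964025146992493080837

lemma chk12h5 : chk tab12h5 17 (holeP 12) = true := by
  decide +kernel

/-- Packed table with 12 points outside a hole of size 7. -/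
def tab12h7 : ℕ :=
  1202338745080996005474853970811769478974359127241056384371899564734028228798381232056713315191394278317342513529309186144676606303130969374910572741285290253778787253764437525864458953351920274703200202400568803276332261934253496348487113079577239604961525601477450028095304675332333326193218786993635741905668845780565032412757829622155639918720372704654860238473812180500248741375483310161392494168843473185466030091987064046845931304657828804171416282262652907462078730684877690866028533526204935683803697380920873045137550645322645931020051830315374865306038737645525059305095451559210239163927477989329045777833280061863725941657734

lemma chk12h7 : chk tab12h7 19 (holeP 12) = true := by
  decide +kernel

/-- Packed table with 12 points outside a hole of size 8. -/
def tab12h8 : ℕ :=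
  183643176933873230770661795734608600112404405561437326105283740624068609158882029067316624956690287339252603506601091153370245700558378705307681281643494295222425184615582949857305970648200645927205147373881714401997211451970481577636097470710291129999908046241211874910520724006177803342785218937478606108702906540113548523185781635211674690746923630572806574503170204177414561643779287521196953062764619343467632876579433716200459271561975211624128110653769654934433293590999301206821597457425257416166503613785923288949237847922809816403677129222837349074697468703676802243966864013936578505851307637739667036228256837982840151102153737165094288327382915376723317237136299867299398682352766405989123494035

lemma chk12h8 : chk tab12h8 20 (holeP 12) = true := by
  decide +kernel

/-- Packed table with 12 points outside a hole of size 10. -/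
def tab12h10 : ℕ :=
  2348186916326367319242624666114835143250423902955826272854445453848679341874998529183800770524169996320074855813232635279238543573891161727839480006194038428021527389164499490450639808124229606843924531218443307872582524400616903481307924369220689163012650441305491508527776771003542674156981170915986236185399976907723174746290838790212437647641085782786116470017553210337693185002574493338133943475589916484322382958051677439233150486233118461275218562699320848175875576814679959686239177852952686739845330842261540536758531808007124706388334467531783485042355162398822662313772879413712565130854845843875288473712906306907076777035085794308321599823617717888206883848048814372077872375670451104512267566009809394264094058816852870859644315437298500622845436928125241492268860113225312066772929842194035305589232554147126532565860044942285174150232805525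

lemma chk12h10 : chk tab12h10 22 (holeP 12) = true := by
  decide +kernel

/-- Packed table with 12 points outside a hole of size 11. -/
def tab12h11 : ℕ :=
  50595821856482802365206368137941554428453011209755999528721852024373245143317471812402015610066647353501594677572724131648647996655837800068946188985616199939885042904597509422486751516579377357291253251695710686580374470446691011723094583560050279088984747209386392805888279910045458819588837202993477054528810702897881033825605610886587067186076405541170595473344250170430000873121062820688920387862942116999380576847799964328061351212408534177109288959462568518801727851946500472813374654691996410013240385884577160062062739534060292474805167123218264052542008379729855443173661750821268871778510884878970688264201913186669691487316542066057333963085526640323269285378169544517311463641699712451795356916807797398138836253638697451197149286788521483020761475831199481264526894088076961518453075866613722754101730127677498002863894768262804940121588557392347318473993951125049327806576287712265438375811993305666227920809269969551360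

lemma chk12h11 : chk tab12h11 23 (fun i j => holeP 12 i j && !(exclP i j)) = true := by
  decide +kernel

/-- Packed table with 24 points outside a hole of size 1. -/
def tab24h1 : ℕ :=
  34304718317181492360970473038887740792777146006891468171793640714828557600608085014788520884493704578564202884480637930840075757589103374074349681497606047781665925443541714205430978046617883780631607002663602208402517373320886385248110839163628406563525364779107978661194930364993752669662478710105287531875692318513511067614809812382740636712015556362795732512365702982934749670934224874222471152420818403557939751265825027299657281717278629954621480609825617726506629773141860579996863465566767531187391973633494891331334865214040290477918677371984555666698371050309618395570570340578511256980213573664386747682876386414364375566589424859649869636487515617859209583202171723163192998738210781444044185057418717864408176868175691449435073283955666547026133495160375845174277589252737798619666481420660075186865984725557943139072713111175996317208246379258524661452838089153499512863095847860518770686802622514500701620883771830392264966731412265676719579541915896036474188501726045404804385243614965765255212339987902134504711359852442174057846864546238219561660384573673650866340453893220538022950928881712127847659425059981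

lemma chk24h1 : chk tab24h1 25 (holeP 24) = true := by
  decide +kernel

/-- Packed table with 24 points outside a hole of size 2. -/
def tab24h2 : ℕ :=
  84603811333086755872318793339086407383649771467642338266128727455446510888233893031567927704441064664426240257079351208890696917351126704239184995385624795540180862588218336427508433174249427221765394503413555550376066661057019984367942333728034893444748520066885193877419832308299067386573903290521305005059576654864577433425981859216249177410961051674359750139875336436611148714570476621529304234401887056456317052179553613622285823605920449520447594838464476925091677403917211302995594142391616785365744116611605213455430818209146102984980652883563558959373716904500177955765016123413012623339721807705276044646878152904452130092526456369628679747453545435059833703244246343904739889093049655942112399622419059668759443140611288681185441044259784814133297230360238856630537435013989386837821278842424642654230553191534571995678719262746319627711654562865118537061799027877089771928420317715798771210582848971840680644079587718899981533683809925399444297366757227582701889820268280927830607914582699496847265116549550116562694712836672802538502787003721953775265644968413743719566612974394407674180310901199251277545764696539018604509850976610910072616940337459939933873298663835969688774960009228353938110159865240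

lemma chk24h2 : chk tab24h2 26 (holeP 24) = true := by
  decide +kernel

/-- Packed table with 24 points outside a hole of size 4. -/
def tab24h4 : ℕ :=
  3132250788125274721249732550548830304299265611967273200684495523758490220494583993103605054474323437963115677337137247654942332697713592096283101626466274375285680441233597732319996705737832680767618393902479769671597704633701670784985845413221069985623170337979219824929094928651151806784546930583569260816440769668044503040836242395967272292681557855507460538224994433966414606629783681851786048584342034348990948796462409283337401581194765754678329672850573734367165738068259528702423302453333604167436634522534206733091518474587845061355747645376759365774537782838974745147721625689450272535013639182971165021131811290382885238609037416481918741854772449627163936824869156339798139412439172719480698021509777862644254851555490721890381813453583403025209525564341621385776614088105431282355970675754014186982935243108467020285004903792370854366777188902749107176277820957067881119322332315893468790713784813737076702721674415471638040612755717874534588555335646801887375441909745462424003697796762286052681441875708010421367658174150772899064233378396408475903733364823334282229693070652141047167176729076291007076004541665530337139929339568856877441597099413529360795578580284672772698317837387423588753561406903746376569035751659753769070081956958478853533708133737107563820329442761814795653478898055913978493451692615622756419080866297419735384373494061832844665240082700794625793695958620826991371405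

lemma chk24h4 : chk tab24h4 28 (holeP 24) = true := by
  decide +kernel

/-- Packed table with 24 points outside a hole of size 5. -/
def tab24h5 : ℕ :=
  1173130650160321714337605017347617162036847844840723529003919582003085602510958473352727558517037155505274140891985474781443292914955235529914764523932006085900684188339310448881534050175211612289600686070401872230782224688567665264830333183340024347265865109386053171600620865874715334071982119291319195231911808299650619370286575638229834290954860002527373629321618833126253333533486931744608270715436394655740699162295723810501772545482891455016433241311730312216550067335265333000485587209686463166631991654575862824419391475721618661607610508435889338836779344373676774071783808853841296324891533968086917550505485919992474582794736287333509783975286266821429661729351034710307238066998145747361146121525931841317031209302942103381810196990765077295258512372795867008295528968395879792357804257449118156968264715643518630509832147805973555433773450086689774024188223892066724243576022356622301752605100396213988399211797529512217091986143480467478409560358993718658498694454141823808346140292191473769174204260414880712761088808057699271966114198829554668731657775820307462468084142696357332162830662370886263060217942938215228449943085800181249382176284575196222163615789150356713588318347842704333752239584425490210472194909255171892616711697604816240470427744815721612620545947150149235393188996947392083971858399695742505082681543797873941251016736143795166862553486231701615793254502948917986079147192027994589980842224821169788104987531129271007943325923748263332954704171140376365892808141149913609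

lemma chk24h5 : chk tab24h5 29 (holeP 24) = true := by
  decide +kernel

/-- Packed table with 24 points outside a hole of size 7. -/
def tab24h7 : ℕ :=
  1540862041181815874242641436698996571367923949087227095621395205282719102689912957305463271884111459536185899572627696626612995555759316128098716187816301681767091274335379601421622058615073429293575544072566557329436734203021284213193191672810046165019157340385846145966064495501538836008217389842813892607403343824897616009202784646409833853094803742111486306673868658698878355851911313518302228504523959191973087715774084754007456989648693734511685354378704289380554637542067846715911491487549706988982041483565309102636414184838299621558538453166540881391015549782350425976310596078041098901136062200602002871083228238170955058859716124615058169946457896492297111338115472602939003950116012042242287315927769503298929377050494855755798294347658649948378006532167535978289716174029233102047072304868040213145501493394140434156841805846845640487048259322896459795520142246807957746126120758145451567922008178287653912250559232607147100997896365951333949352685908342293601115732410860972969505034798683802392013816029086917436968247413970596585964954822619015224439897486160197660779233170614292459605407713798191905276440025357045575719695988166556193788206973776195063930486966022793249322031484809533595142853392100819831180132376230272416526165891212750583566319976373083752266643833170719044430538333987646200359477996580082121162691792245724303068787015214301545106654772132986575409811046804523127391256628769764113672031796459869424231421714908675640554953312376860643868606524732242740228375005403127601993503282342892372777838628321428752861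5594327025669795590735980589242387031774660242482821299752662617953885703358790712220339645086065567273712323917401492065066693234349358558295088181402564968987973980885

lemma chk24h7 : chk tab24h7 31 (holeP 24) = true := by
  decide +kernel

/-- Packed table with 24 points outside a hole of size 8. -/
def tab24h8 : ℕ :=
  3803633784592319824996810725239936317598736350644546995688039148596879660465364148683421277150015073495460412757315186092216408444434393906908720228098565463301713909717270558619699525469451728931364999568610215144003485895831089821336399661845878857858259735569792191204467081507098628795289493831894918714269684845429098593264199777135452455486376676063809242218764389333721847636639917925291767208122019838640845350901525536706619141751212342976973184990001074750761828420067439756602014615106480069708891471400511791111919423688207802486612615567993816976989467418848468647508912896884389989559740386581636945992351426732382945097382953859841151562204373107299105274521511961439373868463728705438096268615786733888059450736659644067102828398892406193853752081603452510867422941913801986820913839621367691604428830400177792645907296775720655051757971498236662661277570706138133536323487941820035373350547889424114127649134407806372527750335100717660201846622562703494785885853953271344457551627621994973139935828330222120220726896716398587765687289067563190085145010332569709855276022698709289374469753612374872940835091313962306272229544657573360366796026209833129998212420685579679939242237410222982824591121810745416132204185786970118495291204308688693251184943747323763565884858172967038532793917088132306221592134293888369529493931478033691583740636020460206304041399784875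2685116202388727327193955299299715833434619915449990880730554968878565961528884928633809566248057011699242082096286246687330368022719201418704498853736851190203443693011219716740649310023762369531745627770539333604299937056823628030154841318000208373512334896254028515541023424467730137934071846035060633309806051278453415740241637369585391598573581551269161368392784275850748731582279895623948669321029866206552632572219447863286329427853264800631768075

lemma chk24h8 : chk tab24h8 32 (holeP 24) = true := by
  decide +kernel

/-- Packed table with 24 points outside a hole of size 10. -/
def tab24h10 : ℕ :=
  1329459712284162373792463407066742797057442505217459205551805433969819577381100975715907286318246205592980676419245695665286826112008273611083402106503188148751651715221078822215511494124109509948302957553270802174117975883659606523065037260215076609486807580718408991180862407082141538905464560236791517867720948433539298660823298114770014270217849120333373648766993865206555426617909911082801433476841588952458569992992561382984668722664446967183132140221967417967683802921408255163398305192851164090486257850017005196959343196678744228587893113551553199512145418749754685773248638534131304253831877577207146385763531388983799411271129303507568067122452037474218622110413033060301125220892692204293067289156485258597796460448692670916855259343549769242318959535319188427386305924647574216231656812874804925486298718971157785766510376343829567942024486589818004405959790966021269232079736420819140751097087499237757142770377412342436071046557088201059045821824481154371827548020680370868798266100831576648663521564150583800375862974423434602734393003930554179759464669245289149299144976970598412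62322343863709200435329770381191223070453694908173332889690741619627101865734160228553676323751478183371298242579277055548437870227611240060264199444384378517392711293186456170478227667548729497195611081034340254993077543359436919180721106247054525344047260522066341042190686075166396109274595806476071411212477761856151662664551569363209015521981825047469831839766144684456060719143010591850124123483080552821544742917475099067137138463562884215623265380062284037801927309974737711115154823784796146596837923047368851892584688282802157547788491684899843192039594292353066545568478482068972451089876761411329141903892560532584277478192205338986683509458486675548103674487272614655457932791440891515837131549018811694684045707164012449454015373154270760472347005509613729925336459921268100025083883550473054013916165400725418129254806481870856875429927815948121034176685556180896770557790497446596605970357024907858905837513155109498045826696586139574417440855044986073268225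

lemma chk24h10 : chk tab24h10 34 (holeP 24) = true := by
  decide +kernel

/-- Packed table with 24 points outside a hole of size 11. -/
def tab24h11 : ℕ :=
  7988366159275335553429873650249340028621820660460737281308363198455612979930497529611660047632573039602405812868206344716528774251020613382817660428936286670682403759186815592863213837357289430899091754206779666748770280278004292885829937060220069515599281837251914122921286896304739458036680617114874945406319457410040851421536259864385995973247267929356570787144926659929909758183183161855282167444327030918907671621588030755706373112612369897319763363946791581485763971051848170584829177979809495254965581905025254801692626424876226719043795167034060860436544751554273719145810404778813389950833219593029650877737685345341745541248762822644797984271359417426500008638844712497795544680523920911864673336121771284401814325448047067337461637649914234449830728288030595861228461865604762848532133999114537544105396243894881420489992155073632160524678049618243627470790145795544280298847921557671753672145276964305088257845474981934409807043735597044440913634004364105752022105110521261186557469101805320334357516957910151103250583673132617398748431317906957542370730749865556178708918894663020704591139741930083517625525906513052489798259187130468037446161701650408764628529054427574507362912048407029013423248330071359701058971132648396153234868713712647374476170483805683828080141899077979339208936012377959719140184148119006811282577582720500694046144908205063621573186962790048449628562462128954018457358394518528598904743678489854454778251753989680920605746273558451611317269746952465734358114980760034045151020201730849934032442624171519494644679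5153776569608251748658514163361699173943648590535606040554420301480451454238098653435885995514736889638433511079211356596946573586037549601034273255843767223513665643023882909140015220525938379879562661022170444599074528274693434818739754758466199080847459164227160490917046007572939335478871482428638372034222038938287151504600554286348138496039199234491038914067983810078351204556353847843319444439000489460423137018612889230372623640978901587442349334694671794672980343214491875844282010176380838728919646531982309492417639967694863473589019257775450595834423002453612104378266126718317541498736120709092667203163174235499070946938470469

lemma chk24h11 : chk tab24h11 35 (holeP 24) = true := by
  decide +kernel


/-- The points of the `c`-th pentagon copy. -/
def pentMap (c : Fin 4) : Fin 5 → Fin 23 :=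
  ![Fin.ofNat 23 (3 * c), Fin.ofNat 23 (3 * c + 1), Fin.ofNat 23 (3 * c + 2), 12, 13]

/-- The pieces used for the hole of size eleven. -/
def elevenP : Option (Fin 4) → Finset (Fin 23 × Fin 23)
  | none => Finset.univ.filter fun t : Fin 23 × Fin 23 =>
      (holeP 12 t.1 t.2 && !(exclP t.1 t.2)) = true
  | some c => (Finset.univ.filter fun t : Fin 5 × Fin 5 => ¬(3 ≤ t.1 ∧ 3 ≤ t.2)).image
      (Prod.map (pentMap c) (pentMap c))

lemma pent_cover : ∀ i j : Fin 23, exclP i j = true → ∃ c : Fin 4, ∃ a b : Fin 5,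
    ¬(3 ≤ a ∧ 3 ≤ b) ∧ pentMap c a = i ∧ pentMap c b = j := by
  have key : ∀ i j : Fin 23, exclP i j = true →
      ¬(3 ≤ Fin.ofNat 5 (if (i : ℕ) < 12 then i % 3 else i - 9) ∧
        3 ≤ Fin.ofNat 5 (if (j : ℕ) < 12 then j % 3 else j - 9)) ∧
      pentMap (Fin.ofNat 4 (if (i : ℕ) < 12 then i / 3 else j / 3))
        (Fin.ofNat 5 (if (i : ℕ) < 12 then i % 3 else i - 9)) = i ∧
      pentMap (Fin.ofNat 4 (if (i : ℕ) < 12 then i / 3 else j / 3))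
        (Fin.ofNat 5 (if (j : ℕ) < 12 then j % 3 else j - 9)) = j := by
    decide +kernel
  exact fun i j hij => ⟨_, _, _, key i j hij⟩

lemma pentMap_inj : ∀ c : Fin 4, ∀ a b : Fin 5, pentMap c a = pentMap c b → a = b := by
  decide +kernel

lemma cov_eleven (n : ℕ) (h : RData n) :
    Cov n (Finset.univ.filter fun t : Fin 23 × Fin 23 => holeP 12 t.1 t.2 = true) := by
  refine Cov.glue (Finset.univ : Finset (Option (Fin 4))) elevenP ?_ _ ?_ ?_
  · rintro (_ | c) -
    · exact cov_table n h tab12h11 23 (fun i j => holeP 12 i j && !(exclP i j)) chk12h11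
    · exact (cov_pent n h).map (pentMap c) (fun a b hab => pentMap_inj c a b hab)
  · rintro ⟨i, j⟩ hij
    have hij : holeP 12 i j = true := (Finset.mem_filter.1 hij).2
    by_cases he : exclP i j = true
    · obtain ⟨c, a, b, h1, h2, h3⟩ := pent_cover i j he
      refine ⟨some c, Finset.mem_univ _, Finset.mem_image.2 ⟨(a, b), ?_, ?_⟩⟩
      · exact Finset.mem_filter.2 ⟨Finset.mem_univ _, h1⟩
      · exact Prod.ext h2 h3
    · refine ⟨none, Finset.mem_univ _, Finset.mem_filter.2 ⟨Finset.mem_univ _, ?_⟩⟩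
      simp [hij, he]
  · decide +kernel

lemma cov_one (n : ℕ) (h : RData n) (r : ℕ)
    (hr : r = 1 ∨ r = 2 ∨ r = 4 ∨ r = 5 ∨ r = 7 ∨ r = 8 ∨ r = 10 ∨ r = 11) :
    Cov n (Finset.univ.filter fun t : Fin (12 + r) × Fin (12 + r) =>
      holeP 12 t.1 t.2 = true) := by
  rcases hr with rfl | rfl | rfl | rfl | rfl | rfl | rfl | rfl
  · exact cov_table n h _ _ _ chk12h1
  · exact cov_table n h _ _ _ chk12h2
  · exact cov_table n h _ _ _ chk12h4
  · exact cov_table n h _ _ _ chk12h5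
  · exact cov_table n h _ _ _ chk12h7
  · exact cov_table n h _ _ _ chk12h8
  · exact cov_table n h _ _ _ chk12h10
  · exact cov_eleven n h

lemma cov_two (n : ℕ) (h : RData n) (r : ℕ)
    (hr : r = 1 ∨ r = 2 ∨ r = 4 ∨ r = 5 ∨ r = 7 ∨ r = 8 ∨ r = 10 ∨ r = 11) :
    Cov n (Finset.univ.filter fun t : Fin (24 + r) × Fin (24 + r) =>
      holeP 24 t.1 t.2 = true) := by
  rcases hr with rfl | rfl | rfl | rfl | rfl | rfl | rfl | rfl
  · exact cov_table n h _ _ _ chk24h1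
  · exact cov_table n h _ _ _ chk24h2
  · exact cov_table n h _ _ _ chk24h4
  · exact cov_table n h _ _ _ chk24h5
  · exact cov_table n h _ _ _ chk24h7
  · exact cov_table n h _ _ _ chk24h8
  · exact cov_table n h _ _ _ chk24h10
  · exact cov_table n h _ _ _ chk24h11

lemma holeP_iff (N i j : ℕ) : holeP N i j = true ↔ ¬ (N ≤ i ∧ N ≤ j) := by
  simp only [holeP, Bool.or_eq_true, Nat.blt_eq]
  omega

lemma card_holeE {α : Type} [Fintype α] [DecidableEq α] (H : Finset α) :
    (Finset.univ.filter fun t : α × α => ¬ (t.1 ∈ H ∧ t.2 ∈ H)).card + H.card ^ 2 =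
      Fintype.card α ^ 2 := by
  have h1 := Finset.card_filter_add_card_filter_not (s := (Finset.univ : Finset (α × α)))
    (fun t : α × α => t.1 ∈ H ∧ t.2 ∈ H)
  have h2 : (Finset.univ.filter fun t : α × α => t.1 ∈ H ∧ t.2 ∈ H) = H ×ˢ H := by
    ext t; simp
  rw [h2, Finset.card_product, Finset.card_univ, Fintype.card_prod] at h1
  rw [sq, sq]
  omega

/-- The hole of a standard point set. -/
def stdHole (N r : ℕ) : Finset (Fin (N + r)) := Finset.univ.filter fun i => N ≤ (i : ℕ)

lemma card_stdHole (N r : ℕ) : (stdHole N r).card = r := by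
  have : stdHole N r = Finset.univ.image (Fin.natAdd N : Fin r → Fin (N + r)) := by
    ext i
    simp only [stdHole, Finset.mem_filter, Finset.mem_univ, true_and, Finset.mem_image]
    constructor
    · intro hi
      exact ⟨⟨i - N, by omega⟩, Fin.ext (by simp; omega)⟩
    · rintro ⟨a, rfl⟩
      simp
  rw [this, Finset.card_image_of_injective _ (Fin.natAdd_injective r N)]
  simp

lemma std_eq (N r : ℕ) : (Finset.univ.filter fun t : Fin (N + r) × Fin (N + r) =>
      holeP N t.1 t.2 = true) = (Finset.univ.filter fun t : Fin (N + r) × Fin (N + r) =>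
      ¬ (t.1 ∈ stdHole N r ∧ t.2 ∈ stdHole N r)) := by
  ext t
  simp only [Finset.mem_filter, Finset.mem_univ, true_and, holeP_iff, stdHole]

lemma cov_std (n N r : ℕ) (h : Cov n (Finset.univ.filter fun t : Fin (N + r) × Fin (N + r) =>
      holeP N t.1 t.2 = true)) : ∃ R : Finset (Fin (N + r)), R.card = r ∧
      Cov n (Finset.univ.filter fun t : Fin (N + r) × Fin (N + r) => ¬ (t.1 ∈ R ∧ t.2 ∈ R)) :=
  ⟨stdHole N r, card_stdHole N r, by rw [← std_eq]; exact h⟩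

lemma cov_equiv (n m : ℕ) {α : Type} [Fintype α] [DecidableEq α] (H : Finset α)
    (hm : Fintype.card α = m)
    (h : Cov n (Finset.univ.filter fun t : α × α => ¬ (t.1 ∈ H ∧ t.2 ∈ H))) :
    ∃ R : Finset (Fin m), R.card = H.card ∧
      Cov n (Finset.univ.filter fun t : Fin m × Fin m => ¬ (t.1 ∈ R ∧ t.2 ∈ R)) := by
  let e : α ≃ Fin m := Fintype.equivFinOfCardEq hm
  refine ⟨H.image e, Finset.card_image_of_injective _ e.injective, ?_⟩
  convert h.map e e.injective using 1
  ext ⟨a, b⟩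
  obtain ⟨a, rfl⟩ := e.surjective a
  obtain ⟨b, rfl⟩ := e.surjective b
  simp
  exact ⟨fun h1 ha => h1 a ha rfl, fun h1 x hx hxa => h1 (hxa ▸ hx)⟩

/-- The points of a group together with the hole. -/
def grpMap (t r : ℕ) (x : Fin t) (i : Fin (12 + r)) : (Fin t × Fin 12) ⊕ Fin r :=
  Sum.map (fun a => (x, a)) id (finSumFinEquiv.symm i)

lemma grpMap_inj (t r : ℕ) (x : Fin t) : Function.Injective (grpMap t r x) := by
  refine Function.Injective.comp (Sum.map_injective.2 ⟨fun a b hab => ?_, fun a b h => h⟩)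
    finSumFinEquiv.symm.injective
  exact (Prod.mk.inj hab).2

lemma grpMap_left (t r : ℕ) (x : Fin t) (a : Fin 12) :
    grpMap t r x (Fin.castAdd r a) = Sum.inl (x, a) := by
  simp [grpMap]

lemma grpMap_right (t r : ℕ) (x : Fin t) (a : Fin r) :
    grpMap t r x (Fin.natAdd 12 a) = Sum.inr a := by
  simp [grpMap]

/-- Pieces of the general recursive construction. -/
def genP (t r : ℕ) : Option (Fin t) →
    Finset (((Fin t × Fin 12) ⊕ Fin r) × ((Fin t × Fin 12) ⊕ Fin r))
  | none => (Finset.univ.filter fun u : (Fin t × Fin 12) × (Fin t × Fin 12) =>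
      u.1.1 ≠ u.2.1).image (Prod.map Sum.inl Sum.inl)
  | some x => (Finset.univ.filter fun u : Fin (12 + r) × Fin (12 + r) =>
      holeP 12 u.1 u.2 = true).image (Prod.map (grpMap t r x) (grpMap t r x))

lemma card_cross (t : ℕ) : (Finset.univ.filter fun u : (Fin t × Fin 12) × (Fin t × Fin 12) =>
      u.1.1 ≠ u.2.1).card + 144 * t ≤ (12 * t) ^ 2 := by
  have h1 := Finset.card_filter_add_card_filter_not
    (s := (Finset.univ : Finset ((Fin t × Fin 12) × (Fin t × Fin 12)))) (fun u => u.1.1 = u.2.1)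
  have h2 : (Finset.univ : Finset (Fin t × Fin 12 × Fin 12)).card ≤
      (Finset.univ.filter fun u : (Fin t × Fin 12) × (Fin t × Fin 12) => u.1.1 = u.2.1).card := by
    refine Finset.card_le_card_of_injOn (fun v => ((v.1, v.2.1), (v.1, v.2.2))) ?_ ?_
    · intro v _
      simp
    · rintro ⟨a, b, c⟩ _ ⟨a', b', c'⟩ _ hab
      simp only [Prod.mk.injEq] at hab ⊢
      tauto
  simp only [Finset.card_univ, Fintype.card_prod, Fintype.card_fin] at h1 h2
  nlinarith

lemma cov_gen (n : ℕ) (h : RData n) (t r : ℕ) (ht : 3 ≤ t)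
    (hr : r = 1 ∨ r = 2 ∨ r = 4 ∨ r = 5 ∨ r = 7 ∨ r = 8 ∨ r = 10 ∨ r = 11) :
    Cov n (Finset.univ.filter fun u : ((Fin t × Fin 12) ⊕ Fin r) × ((Fin t × Fin 12) ⊕ Fin r) =>
      ¬ (u.1 ∈ Finset.univ.image (Sum.inr : Fin r → (Fin t × Fin 12) ⊕ Fin r) ∧
        u.2 ∈ Finset.univ.image (Sum.inr : Fin r → (Fin t × Fin 12) ⊕ Fin r))) := by
  refine Cov.glue (Finset.univ : Finset (Option (Fin t))) (genP t r) ?_ _ ?_ ?_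
  · rintro (_ | x) -
    · exact (cov_gdd n h t ht).map _ Sum.inl_injective
    · exact (cov_one n h r hr).map _ (grpMap_inj t r x)
  · have grp : ∀ x i j, holeP 12 (i : Fin (12 + r)) (j : Fin (12 + r)) = true →
        ∃ b ∈ (Finset.univ : Finset (Option (Fin t))), (grpMap t r x i, grpMap t r x j) ∈
          genP t r b := by
      intro x i j hij
      refine ⟨some x, Finset.mem_univ _, Finset.mem_image.2 ⟨(i, j), ?_, rfl⟩⟩
      simpa using hij
    rintro ⟨⟨x, a⟩ | a, ⟨y, b⟩ | b⟩ hu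
    · by_cases hxy : x = y
      · subst hxy
        have := grp x (Fin.castAdd r a) (Fin.castAdd r b) (by
          rw [holeP_iff]; simp)
        rwa [grpMap_left, grpMap_left] at this
      · refine ⟨none, Finset.mem_univ _, Finset.mem_image.2 ⟨((x, a), (y, b)), ?_, rfl⟩⟩
        simpa using hxy
    · have := grp x (Fin.castAdd r a) (Fin.natAdd 12 b) (by
        rw [holeP_iff]; simp)
      rwa [grpMap_left, grpMap_right] at this
    · have := grp y (Fin.natAdd 12 a) (Fin.castAdd r b) (by
        rw [holeP_iff]; simp)
      rwa [grpMap_left, grpMap_right] at this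
    · simp at hu
  · have hE := card_holeE (Finset.univ.image (Sum.inr : Fin r → (Fin t × Fin 12) ⊕ Fin r))
    rw [Finset.card_image_of_injective _ Sum.inr_injective] at hE
    simp only [Finset.card_univ, Fintype.card_fin, Fintype.card_sum, Fintype.card_prod] at hE
    rw [Fintype.sum_option]
    have c1 : (genP t r none).card + 144 * t ≤ (12 * t) ^ 2 :=
      (Nat.add_le_add_right Finset.card_image_le _).trans (card_cross t)
    have c2 : ∀ x, (genP t r (some x)).card ≤ 144 + 24 * r := by
      intro x
      refine Finset.card_image_le.trans ?_
      have h3 := card_holeE (stdHole 12 r)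
      rw [← std_eq, card_stdHole, Fintype.card_fin] at h3
      nlinarith
    have c3 : ∑ x : Fin t, (genP t r (some x)).card ≤ t * (144 + 24 * r) := by
      have := Finset.sum_le_card_nsmul (Finset.univ : Finset (Fin t))
        (fun x => (genP t r (some x)).card) (144 + 24 * r) (fun x _ => c2 x)
      simpa using this
    nlinarith

lemma cov_final (n : ℕ) (h : RData n) (m r : ℕ)
    (hr : r = 1 ∨ r = 2 ∨ r = 4 ∨ r = 5 ∨ r = 7 ∨ r = 8 ∨ r = 10 ∨ r = 11)
    (hmr : m % 12 = r) (hm : 13 ≤ m) : ∃ R : Finset (Fin m), R.card = r ∧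
      Cov n (Finset.univ.filter fun t : Fin m × Fin m => ¬ (t.1 ∈ R ∧ t.2 ∈ R)) := by
  obtain ⟨t, rfl⟩ : ∃ t, m = 12 * t + r := ⟨m / 12, by omega⟩
  have ht : t = 1 ∨ t = 2 ∨ 3 ≤ t := by omega
  rcases ht with rfl | rfl | ht
  · exact cov_std n 12 r (cov_one n h r hr)
  · exact cov_std n 24 r (cov_two n h r hr)
  · obtain ⟨R, hR, hc⟩ := cov_equiv n (12 * t + r) _ (by simp [mul_comm]) (cov_gen n h t r ht hr)
    refine ⟨R, ?_, hc⟩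
    rw [hR, Finset.card_image_of_injective _ Sum.inr_injective]
    simp

theorem stmt_14 (m r n : ℕ)
    (hr : r = 1 ∨ r = 2 ∨ r = 4 ∨ r = 5 ∨ r = 7 ∨ r = 8 ∨ r = 10 ∨ r = 11)
    (hmr : m % 12 = r) (hm : 13 ≤ m) (hn : n % 8 = 0 ∨ n % 8 = 2) (hn8 : 8 ≤ n) :
    ∃ (R : Finset (Fin m)) (C : Finset (Finset (Fin m × ZMod n))),
      R.card = r ∧ IsGRegOOC 3 2 R C ∧
      C.card = (m ^ 2 - r ^ 2) * (n - 2) / 6 := by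
  haveI : NeZero n := ⟨by omega⟩
  obtain ⟨R, hR, hcov⟩ := cov_final n (rdata n hn hn8) m r hr hmr hm
  obtain ⟨C, h1, h2, h3⟩ := code_of_cov m n (by omega) _ hcov
  refine ⟨R, C, hR, ⟨h1, ?_⟩, ?_⟩
  · intro i j z
    rw [h2 i j z]
    simp only [Finset.mem_filter, Finset.mem_univ, true_and]
    by_cases a : i ∈ R ∧ j ∈ R
    · rw [if_pos a, if_neg (fun b => b.1 a)]
    · rw [if_neg a]
      by_cases b : (2 : ℕ) • z = 0
      · rw [if_pos b, if_neg (fun c => c.2 b)]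
      · rw [if_neg b, if_pos ⟨a, b⟩]
  · have h4 := card_holeE R
    rw [hR, Fintype.card_fin] at h4
    have h5 : m ^ 2 - r ^ 2 = (Finset.univ.filter fun t : Fin m × Fin m =>
      ¬ (t.1 ∈ R ∧ t.2 ∈ R)).card := by omega
    rw [h5, ← h3]
    omega
end

section
/- For every positive integer n with n ≡ 0 or 6 (mod 8), there exists a 2-D ([5:2]×n,3,1)-OOC with Θ(5,2,n,3) = (7n−2)/2 codewords. -/
namespace OOC15

/-! ### Part 1: an abstract criterion -/

/-- First member of the `p`-th pair of positions `01, 02, 12`. -/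
def fs : Fin 3 → Fin 3 := ![0, 0, 1]
/-- Second member of the `p`-th pair of positions `01, 02, 12`. -/
def sn : Fin 3 → Fin 3 := ![1, 2, 2]

lemma pair_cases : ∀ a b : Fin 3, a ≠ b → ∃ p, (a = fs p ∧ b = sn p) ∨ (a = sn p ∧ b = fs p) := by
  decide

lemma zmod_small {n : ℕ} {z : ℤ} (h : ((z : ℤ) : ZMod n) = 0) (h1 : -(n : ℤ) < z)
    (h2 : z < n) : z = 0 := by
  rw [ZMod.intCast_zmod_eq_zero_iff_dvd] at h
  exact Int.eq_zero_of_abs_lt_dvd h (abs_lt.2 ⟨h1, h2⟩)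

/-- Normalised difference data for an indexed family of triples. -/
structure Good {ι : Type} (n : ℕ) (I : Finset ι) (row : ι → Fin 3 → Fin 5)
    (c d : ι → Fin 3 → ℤ) : Prop where
  mono : ∀ t ∈ I, ∀ p, row t (fs p) ≤ row t (sn p)
  mixed : ∀ t ∈ I, ∀ p, row t (fs p) ≠ row t (sn p) →
    (d t p : ZMod n) = c t (sn p) - c t (fs p) ∧ 0 ≤ d t p ∧ d t p < n
  pure : ∀ t ∈ I, ∀ p, row t (fs p) = row t (sn p) →
    ((d t p : ZMod n) = c t (sn p) - c t (fs p) ∨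
      (d t p : ZMod n) = -((c t (sn p) : ZMod n) - c t (fs p))) ∧ 0 < d t p ∧ 2 * d t p < n
  hole : ∀ t ∈ I, ∀ p, 2 ≤ row t (sn p)
  inj : ∀ t ∈ I, ∀ t' ∈ I, ∀ p p', row t (fs p) = row t' (fs p') →
    row t (sn p) = row t' (sn p') → d t p = d t' p' → t = t' ∧ p = p'

section
variable {ι : Type} {n : ℕ} {I : Finset ι} {row : ι → Fin 3 → Fin 5} {c d : ι → Fin 3 → ℤ}

lemma Good.same (G : Good n I row c d) {t t' : ι} (ht : t ∈ I) (ht' : t' ∈ I) {p p' : Fin 3}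
    (h1 : row t (fs p) = row t' (fs p')) (h2 : row t (sn p) = row t' (sn p'))
    (h3 : (c t (sn p) : ZMod n) - c t (fs p) = c t' (sn p') - c t' (fs p')) :
    t = t' ∧ p = p' := by
  apply G.inj t ht t' ht' p p' h1 h2
  by_cases hr : row t (fs p) = row t (sn p)
  · obtain ⟨e1, l1, u1⟩ := G.pure t ht p hr
    obtain ⟨e2, l2, u2⟩ := G.pure t' ht' p' (by rw [← h1, ← h2, hr])
    rw [← h3] at e2
    have key : (d t p : ZMod n) = d t' p' ∨ (d t p : ZMod n) = - d t' p' := by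
      rcases e1 with e1 | e1 <;> rcases e2 with e2 | e2 <;> rw [e1, e2] <;> simp
    rcases key with k | k
    · have := zmod_small (n := n) (z := d t p - d t' p') (by push_cast; rw [k]; ring)
        (by linarith) (by linarith)
      linarith
    · have := zmod_small (n := n) (z := d t p + d t' p') (by push_cast; rw [k]; ring)
        (by linarith) (by linarith)
      linarith
  · obtain ⟨e1, l1, u1⟩ := G.mixed t ht p hr
    obtain ⟨e2, l2, u2⟩ := G.mixed t' ht' p' (by rw [← h1, ← h2]; exact hr)
    have := zmod_small (n := n) (z := d t p - d t' p') (by push_cast; rw [e1, e2, h3]; ring)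
        (by linarith) (by linarith)
    linarith

lemma Good.opp (G : Good n I row c d) {t t' : ι} (ht : t ∈ I) (ht' : t' ∈ I) {p p' : Fin 3}
    (h1 : row t (fs p) = row t' (sn p')) (h2 : row t (sn p) = row t' (fs p'))
    (h3 : (c t (sn p) : ZMod n) - c t (fs p) = c t' (fs p') - c t' (sn p')) : False := by
  have m1 := G.mono t ht p
  have m2 := G.mono t' ht' p'
  have hr : row t (fs p) = row t (sn p) := le_antisymm m1 (by rw [h2, h1]; exact m2)
  have hr' : row t' (fs p') = row t' (sn p') := by rw [← h1, ← h2, hr]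
  obtain ⟨e1, l1, u1⟩ := G.pure t ht p hr
  obtain ⟨e2, l2, u2⟩ := G.pure t' ht' p' hr'
  have h3' : (c t' (sn p') : ZMod n) - c t' (fs p') = -((c t (sn p) : ZMod n) - c t (fs p)) := by
    rw [h3]; ring
  have key : (d t p : ZMod n) = d t' p' ∨ (d t p : ZMod n) = - d t' p' := by
    rw [h3'] at e2
    rcases e1 with e1 | e1 <;> rcases e2 with e2 | e2 <;> rw [e1, e2] <;> simp
  rcases key with k | k
  · have := zmod_small (n := n) (z := d t p - d t' p') (by push_cast; rw [k]; ring)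
        (by linarith) (by linarith)
    obtain ⟨rfl, rfl⟩ := G.inj t ht t' ht' p p' (by rw [h1, hr']) (by rw [h2, hr']) (by linarith)
    have h4 : (2 : ZMod n) * (c t (sn p) - c t (fs p)) = 0 := by
      linear_combination h3
    have := zmod_small (n := n) (z := 2 * d t p) (by
      push_cast
      rcases e1 with e1 | e1 <;> rw [e1]
      · exact h4
      · linear_combination -h4) (by linarith) (by linarith)
    linarith
  · have := zmod_small (n := n) (z := d t p + d t' p') (by push_cast; rw [k]; ring)
        (by linarith) (by linarith)
    linarith

lemma Good.main (G : Good n I row c d) {t t' : ι} (ht : t ∈ I) (ht' : t' ∈ I) {a b a' b' : Fin 3}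
    (hab : a ≠ b) (hab' : a' ≠ b') (h1 : row t a = row t' a') (h2 : row t b = row t' b')
    (h3 : (c t a : ZMod n) - c t b = c t' a' - c t' b') : t = t' ∧ a = a' ∧ b = b' := by
  obtain ⟨p, ⟨rfl, rfl⟩ | ⟨rfl, rfl⟩⟩ := pair_cases a b hab <;>
  obtain ⟨p', ⟨rfl, rfl⟩ | ⟨rfl, rfl⟩⟩ := pair_cases a' b' hab'
  · obtain ⟨rfl, rfl⟩ := G.same ht ht' h1 h2 (by linear_combination -h3)
    simp
  · exact (G.opp ht ht' h1 h2 (by linear_combination -h3)).elim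
  · exact (G.opp ht ht' h2 h1 (by linear_combination h3)).elim
  · obtain ⟨rfl, rfl⟩ := G.same ht ht' h2 h1 (by linear_combination h3)
    simp

/-- The point in position `a` of the triple `t`. -/
def pt (n : ℕ) (row : ι → Fin 3 → Fin 5) (c : ι → Fin 3 → ℤ) (t : ι) (a : Fin 3) :
    Fin 5 × ZMod n := (row t a, (c t a : ZMod n))

/-- The codeword with index `t`. -/
def cw (n : ℕ) (row : ι → Fin 3 → Fin 5) (c : ι → Fin 3 → ℤ) (t : ι) :
    Finset (Fin 5 × ZMod n) := Finset.univ.image (pt n row c t)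

lemma Good.pt_inj (G : Good n I row c d) {t : ι} (ht : t ∈ I) :
    Function.Injective (pt n row c t) := by
  intro a b hab
  by_contra hne
  simp only [pt, Prod.mk.injEq] at hab
  have := G.main ht ht hne (Ne.symm hne) hab.1 hab.1.symm (by rw [hab.2])
  exact hne this.2.1

lemma Good.card (G : Good n I row c d) {t : ι} (ht : t ∈ I) : (cw n row c t).card = 3 := by
  rw [cw, Finset.card_image_of_injective _ (G.pt_inj ht)]; simp

lemma Good.corr (G : Good n I row c d) {t t' : ι} (ht : t ∈ I) (ht' : t' ∈ I) (τ : ZMod n)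
    (h : ¬ (t = t' ∧ τ = 0)) : (cw n row c t ∩ OOCshift (cw n row c t') τ).card ≤ 1 := by
  rw [Finset.card_le_one]
  intro P hP Q hQ
  by_contra hne
  simp only [cw, OOCshift, Finset.mem_inter, Finset.mem_image, Finset.mem_univ, true_and,
    exists_exists_eq_and] at hP hQ
  obtain ⟨⟨a, rfl⟩, a', ha⟩ := hP
  obtain ⟨⟨b, rfl⟩, b', hb⟩ := hQ
  have hab : a ≠ b := fun e => hne (by rw [e])
  have hab' : a' ≠ b' := by
    rintro rfl
    exact hne (by rw [← ha, ← hb])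
  simp only [pt, Prod.mk.injEq] at ha hb
  obtain ⟨rfl, rfl, rfl⟩ := G.main ht ht' hab hab' ha.1.symm hb.1.symm
    (by rw [← ha.2, ← hb.2]; ring)
  exact h ⟨rfl, by simpa using ha.2⟩

theorem Good.final (G : Good n I row c d) :
    ∃ (R : Finset (Fin 5)) (C : Finset (Finset (Fin 5 × ZMod n))),
      R.card = 2 ∧ IsOOC 5 n 3 1 C ∧ (∀ i ∈ R, ∀ j ∈ R, Delta i j C = 0) ∧
      C.card = I.card := by
  classical
  refine ⟨{0, 1}, I.image (cw n row c), rfl, ⟨?_, ?_, ?_⟩, ?_, ?_⟩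
  · intro A hA
    obtain ⟨t, ht, rfl⟩ := Finset.mem_image.1 hA
    exact G.card ht
  · intro A hA τ hτ
    obtain ⟨t, ht, rfl⟩ := Finset.mem_image.1 hA
    exact G.corr ht ht τ (fun h => hτ h.2)
  · intro A hA B hB hAB τ
    obtain ⟨t, ht, rfl⟩ := Finset.mem_image.1 hA
    obtain ⟨t', ht', rfl⟩ := Finset.mem_image.1 hB
    exact G.corr ht ht' τ (fun h => hAB (by rw [h.1]))
  · intro i hi j hj
    unfold Delta
    apply Finset.sum_eq_zero
    intro B hB
    obtain ⟨t, ht, rfl⟩ := Finset.mem_image.1 hB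
    rw [Multiset.map_eq_zero, Finset.val_eq_zero, Finset.filter_eq_empty_iff]
    rintro ⟨P, Q⟩ hPQ ⟨hne, hi', hj'⟩
    simp only [cw, Finset.mem_product, Finset.mem_image, Finset.mem_univ, true_and] at hPQ
    obtain ⟨⟨a, rfl⟩, b, rfl⟩ := hPQ
    have hab : a ≠ b := fun e => hne (by rw [e])
    have hlt : ∀ i : Fin 5, i ∈ ({0, 1} : Finset (Fin 5)) → i < 2 := by decide
    have ri : i < 2 := hlt i hi
    have rj : j < 2 := hlt j hj
    simp only [pt] at hi' hj'
    obtain ⟨p, ⟨rfl, rfl⟩ | ⟨rfl, rfl⟩⟩ := pair_cases a b hab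
    · exact absurd rj (not_lt.2 (hj' ▸ G.hole t ht p))
    · exact absurd ri (not_lt.2 (hi' ▸ G.hole t ht p))
  · apply Finset.card_image_of_injOn
    intro t ht t' ht' h
    by_contra hne
    have h1 := G.corr ht ht' 0 (fun h => hne h.1)
    have h2 : OOCshift (cw n row c t') 0 = cw n row c t' := by
      simp [OOCshift]
    rw [h2, ← h, Finset.inter_self, G.card ht] at h1
    omega

end

/-! ### Part 2: families that are linear in two parameters, and a checker -/

/-- A moving point: in row `r`, with coordinate `a * j + b + s * x`. -/
structure Pt where
  r : Fin 5
  a : ℤ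
  b : ℤ
  s : ℤ

/-- The coordinate of a moving point. -/
def Pt.val (p : Pt) (j x : ℤ) : ℤ := p.a * j + p.b + p.s * x

/-- A family of triples indexed by `0 ≤ x < la * j + lb`. For the `p`-th pair of positions the
normalised difference is `g * (second - first) + m * n` with `(g, m) = w p`. -/
structure Fam where
  pts : Fin 3 → Pt
  la : ℤ
  lb : ℤ
  w : Fin 3 → ℤ × ℤ

/-- Arithmetic progression `A * j + B + S * x`, `0 ≤ x < la * j + lb`, attached to a row pair. -/
structure AP where
  i : Fin 5
  k : Fin 5
  A : ℤ
  B : ℤ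
  S : ℤ
  la : ℤ
  lb : ℤ

/-- The value of the progression. -/
def AP.val (q : AP) (j x : ℤ) : ℤ := q.A * j + q.B + q.S * x

/-- Normalised differences of a family for `n = N1 * j + N0`. -/
def Fam.key (N1 N0 : ℤ) (f : Fam) (p : Fin 3) : AP where
  i := (f.pts (fs p)).r
  k := (f.pts (sn p)).r
  A := (f.w p).1 * ((f.pts (sn p)).a - (f.pts (fs p)).a) + (f.w p).2 * N1
  B := (f.w p).1 * ((f.pts (sn p)).b - (f.pts (fs p)).b) + (f.w p).2 * N0
  S := (f.w p).1 * ((f.pts (sn p)).s - (f.pts (fs p)).s)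
  la := f.la
  lb := f.lb

/-- Lower bound (coefficients of `j` and `1`). -/
def AP.lo (q : AP) : ℤ × ℤ :=
  if 0 ≤ q.S then (q.A, q.B) else (q.A + q.S * q.la, q.B + q.S * (q.lb - 1))

/-- Upper bound (coefficients of `j` and `1`). -/
def AP.hi (q : AP) : ℤ × ℤ :=
  if 0 ≤ q.S then (q.A + q.S * q.la, q.B + q.S * (q.lb - 1)) else (q.A, q.B)

/-- Sufficient condition for two progressions to have no common difference. -/
def AP.Disj (q q' : AP) : Prop :=
  q.i ≠ q'.i ∨ q.k ≠ q'.k ∨ (q.hi.1 ≤ q'.lo.1 ∧ q.hi.2 < q'.lo.2) ∨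
    (q'.hi.1 ≤ q.lo.1 ∧ q'.hi.2 < q.lo.2) ∨
    ((q.A - q'.A) % 2 = 0 ∧ q.S % 2 = 0 ∧ q'.S % 2 = 0 ∧ (q.B - q'.B) % 2 = 1)

instance (q q' : AP) : Decidable (q.Disj q') := by unfold AP.Disj; infer_instance

/-- Admissibility of one progression (`g` is the sign used). -/
def AP.Ok (N1 N0 g : ℤ) (q : AP) : Prop :=
  q.i ≤ q.k ∧ 2 ≤ q.k ∧ (q.S ≠ 0 ∨ (q.la = 0 ∧ q.lb ≤ 1)) ∧
  (if q.i = q.k then (g = 1 ∨ g = -1) ∧ 0 ≤ q.lo.1 ∧ 0 < q.lo.2 ∧ 2 * q.hi.1 ≤ N1 ∧ 2 * q.hi.2 < N0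
    else g = 1 ∧ 0 ≤ q.lo.1 ∧ 0 ≤ q.lo.2 ∧ q.hi.1 ≤ N1 ∧ q.hi.2 < N0)

instance (N1 N0 g : ℤ) (q : AP) : Decidable (q.Ok N1 N0 g) := by unfold AP.Ok; infer_instance

/-- Admissibility of one family. -/
def Fam.Ok (N1 N0 : ℤ) (f : Fam) : Prop :=
  0 ≤ f.la ∧ 0 ≤ f.lb ∧ (∀ p, (f.key N1 N0 p).Ok N1 N0 (f.w p).1) ∧
  (f.key N1 N0 0).Disj (f.key N1 N0 1) ∧ (f.key N1 N0 0).Disj (f.key N1 N0 2) ∧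
  (f.key N1 N0 1).Disj (f.key N1 N0 2)

instance (N1 N0 : ℤ) (f : Fam) : Decidable (f.Ok N1 N0) := by unfold Fam.Ok; infer_instance

/-- All checks. -/
def Check (N1 N0 : ℤ) (F : List Fam) : Prop :=
  (∀ f ∈ F, f.Ok N1 N0) ∧
  F.Pairwise (fun f f' => ∀ p p', (f.key N1 N0 p).Disj (f'.key N1 N0 p')) ∧
  2 * (F.map Fam.la).sum = 7 * N1 ∧ 2 * (F.map Fam.lb).sum = 7 * N0 - 2

instance (N1 N0 : ℤ) (F : List Fam) : Decidable (Check N1 N0 F) := by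
  unfold Check; infer_instance

lemma AP.lo_le (q : AP) {j x : ℤ} (hx : 0 ≤ x) (hx' : x < q.la * j + q.lb) :
    q.lo.1 * j + q.lo.2 ≤ q.val j x := by
  unfold AP.lo AP.val
  split_ifs with h
  · simp only; nlinarith
  · simp only; nlinarith [mul_nonneg (a := -q.S) (b := q.la * j + q.lb - 1 - x) (by linarith) (by linarith)]

lemma AP.le_hi (q : AP) {j x : ℤ} (hx : 0 ≤ x) (hx' : x < q.la * j + q.lb) :
    q.val j x ≤ q.hi.1 * j + q.hi.2 := by
  unfold AP.hi AP.val
  split_ifs with h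
  · simp only; nlinarith [mul_nonneg (a := q.S) (b := q.la * j + q.lb - 1 - x) (by linarith) (by linarith)]
  · simp only; nlinarith

lemma AP.Disj.symm {q q' : AP} (h : q.Disj q') : q'.Disj q := by
  unfold AP.Disj at *
  rcases h with h | h | h | h | h
  · exact Or.inl h.symm
  · exact Or.inr (Or.inl h.symm)
  · tauto
  · tauto
  · right; right; right; right
    omega

lemma AP.Disj.ne {q q' : AP} (h : q.Disj q') {j x x' : ℤ} (hj : 0 ≤ j) (hx : 0 ≤ x)
    (hx1 : x < q.la * j + q.lb) (hx' : 0 ≤ x') (hx1' : x' < q'.la * j + q'.lb)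
    (hi : q.i = q'.i) (hk : q.k = q'.k) : q.val j x ≠ q'.val j x' := by
  intro e
  have a1 := q.lo_le hx hx1
  have a2 := q.le_hi hx hx1
  have b1 := q'.lo_le hx' hx1'
  have b2 := q'.le_hi hx' hx1'
  rcases h with h | h | h | h | ⟨h1, h2, h3, h4⟩
  · exact h hi
  · exact h hk
  · nlinarith
  · nlinarith
  · unfold AP.val at e
    obtain ⟨u, hu⟩ := Int.dvd_of_emod_eq_zero h1
    obtain ⟨v, hv⟩ := Int.dvd_of_emod_eq_zero h2
    obtain ⟨v', hv'⟩ := Int.dvd_of_emod_eq_zero h3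
    have : q.B - q'.B = 2 * (v' * x' - v * x - u * j) := by
      linear_combination e - j * hu - x * hv + x' * hv'
    omega

theorem Check.main {N1 N0 : ℤ} {F : List Fam} (H : Check N1 N0 F) (j n : ℕ)
    (hn : (n : ℤ) = N1 * j + N0) :
    ∃ (R : Finset (Fin 5)) (C : Finset (Finset (Fin 5 × ZMod n))),
      R.card = 2 ∧ IsOOC 5 n 3 1 C ∧ (∀ i ∈ R, ∀ j ∈ R, Delta i j C = 0) ∧
      C.card = (7 * n - 2) / 2 := by
  obtain ⟨hok, hpw, hla, hlb⟩ := H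
  have hj : (0 : ℤ) ≤ j := Int.natCast_nonneg j
  let I : Finset ((_ : Fin F.length) × ℕ) :=
    Finset.univ.sigma fun f => Finset.range (F[f].la * j + F[f].lb).toNat
  have hI : ∀ t ∈ I, (t.2 : ℤ) < F[t.1].la * j + F[t.1].lb := by
    intro t ht
    simp only [I, Finset.mem_sigma, Finset.mem_univ, true_and, Finset.mem_range] at ht
    omega
  have hO : ∀ t : (_ : Fin F.length) × ℕ, F[t.1].Ok N1 N0 := fun t => hok _ (List.getElem_mem _)
  have hpair : ∀ f f' : Fin F.length, ∀ p p', (f, p) ≠ (f', p') →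
      (F[f].key N1 N0 p).Disj (F[f'].key N1 N0 p') := by
    intro f f' p p' hne
    rw [List.pairwise_iff_getElem] at hpw
    rcases lt_trichotomy f f' with h | h | h
    · exact hpw f f' f.2 f'.2 h p p'
    · subst h
      obtain ⟨-, -, -, d1, d2, d3⟩ := hok F[f] (List.getElem_mem _)
      have hpp : p ≠ p' := fun e => hne (by rw [e])
      fin_cases p <;> fin_cases p' <;> first | exact absurd rfl hpp | assumption | (apply AP.Disj.symm; assumption)
    · exact (hpw f' f f'.2 f.2 h p' p).symm
  have hval : ∀ (t : (_ : Fin F.length) × ℕ) (p : Fin 3), (F[t.1].key N1 N0 p).val j t.2 =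
      (F[t.1].w p).1 * ((F[t.1].pts (sn p)).val j t.2 - (F[t.1].pts (fs p)).val j t.2)
        + (F[t.1].w p).2 * n := by
    intro t p
    simp only [AP.val, Fam.key, Pt.val, hn]
    ring
  have G : Good n I (fun t a => (F[t.1].pts a).r) (fun t a => (F[t.1].pts a).val j t.2)
      (fun t p => (F[t.1].key N1 N0 p).val j t.2) := by
    constructor
    · intro t ht p
      exact ((hO t).2.2.1 p).1
    · intro t ht p hr
      have h := ((hO t).2.2.1 p).2.2.2
      have hr' : ¬ (F[t.1].key N1 N0 p).i = (F[t.1].key N1 N0 p).k := hr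
      rw [if_neg hr'] at h
      obtain ⟨hg, h1, h2, h3, h4⟩ := h
      have a1 := (F[t.1].key N1 N0 p).lo_le (Int.natCast_nonneg t.2) (hI t ht)
      have a2 := (F[t.1].key N1 N0 p).le_hi (Int.natCast_nonneg t.2) (hI t ht)
      refine ⟨?_, ?_, ?_⟩
      · rw [hval, hg]; push_cast; simp
      · nlinarith
      · nlinarith
    · intro t ht p hr
      have h := ((hO t).2.2.1 p).2.2.2
      have hr' : (F[t.1].key N1 N0 p).i = (F[t.1].key N1 N0 p).k := hr
      rw [if_pos hr'] at h
      obtain ⟨hg, h1, h2, h3, h4⟩ := h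
      have a1 := (F[t.1].key N1 N0 p).lo_le (Int.natCast_nonneg t.2) (hI t ht)
      have a2 := (F[t.1].key N1 N0 p).le_hi (Int.natCast_nonneg t.2) (hI t ht)
      refine ⟨?_, ?_, ?_⟩
      · rw [hval]
        rcases hg with hg | hg <;> rw [hg] <;> push_cast <;> simp
      · nlinarith
      · nlinarith
    · intro t ht p
      exact ((hO t).2.2.1 p).2.1
    · intro t ht t' ht' p p' h1 h2 h3
      by_cases hne : (t.1, p) = (t'.1, p')
      · obtain ⟨f, x⟩ := t
        obtain ⟨f', x'⟩ := t'
        simp only [Prod.mk.injEq] at hne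
        obtain ⟨rfl, rfl⟩ := hne
        have hx := hI _ ht
        have hx' := hI _ ht'
        have hs := ((hO ⟨f, x⟩).2.2.1 p).2.2.1
        simp only [AP.val] at h3 hx hx' hs
        have : (x : ℤ) = x' := by
          rcases hs with hs | ⟨hs1, hs2⟩
          · exact mul_left_cancel₀ hs (by linarith)
          · have e1 : F[f].la = 0 := hs1
            have e2 : F[f].lb ≤ 1 := hs2
            rw [e1] at hx hx'
            omega
        have : x = x' := by exact_mod_cast this
        subst this
        exact ⟨rfl, rfl⟩
      · exact absurd h3 ((hpair _ _ _ _ hne).ne hj (Int.natCast_nonneg _) (hI t ht)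
          (Int.natCast_nonneg _) (hI t' ht') h1 h2)
  obtain ⟨R, C, hR, hC, hD, hc⟩ := G.final
  refine ⟨R, C, hR, hC, hD, ?_⟩
  rw [hc, Finset.card_sigma]
  simp only [Finset.card_range]
  have hsum : ((∑ f : Fin F.length, (F[f].la * j + F[f].lb).toNat : ℕ) : ℤ) =
      (F.map Fam.la).sum * j + (F.map Fam.lb).sum := by
    have e : ∀ f : Fin F.length, (((F[f].la * j + F[f].lb).toNat : ℕ) : ℤ) =
        F[f].la * j + F[f].lb := by
      intro f
      obtain ⟨h1, h2, -⟩ := hok F[f] (List.getElem_mem _)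
      exact Int.toNat_of_nonneg (by positivity)
    rw [Nat.cast_sum, Finset.sum_congr rfl (fun f _ => e f), Finset.sum_add_distrib,
      ← Finset.sum_mul]
    congr 1
    · congr 1
      exact Fin.sum_univ_fun_getElem F Fam.la
    · exact Fin.sum_univ_fun_getElem F Fam.lb
  have h2 : (2 : ℤ) * ((∑ f : Fin F.length, (F[f].la * j + F[f].lb).toNat : ℕ) : ℤ) = 7 * n - 2 := by
    rw [hsum, hn]
    linear_combination (j : ℤ) * hla + hlb
  omega


/-! ### Part 3: the explicit families -/

/-- Families for `n = 8 * j + 6`. -/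
def fam6 : List Fam := [
  ⟨![⟨2, 0, 0, 0⟩, ⟨3, 0, 1, 1⟩, ⟨4, 8, 5, -1⟩], 4, 2, ![(1, 0), (1, 0), (1, 0)]⟩,
  ⟨![⟨0, 0, 0, 0⟩, ⟨2, 0, 1, 1⟩, ⟨2, 8, 5, -1⟩], 2, 1, ![(1, 0), (1, 0), (-1, 1)]⟩,
  ⟨![⟨0, 0, 0, 0⟩, ⟨2, 4, 3, 1⟩, ⟨2, 4, 2, -1⟩], 2, 1, ![(1, 0), (1, 0), (-1, 0)]⟩,
  ⟨![⟨0, 0, 0, 0⟩, ⟨3, 0, 1, 1⟩, ⟨3, 8, 5, -1⟩], 2, 1, ![(1, 0), (1, 0), (-1, 1)]⟩,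
  ⟨![⟨0, 0, 0, 0⟩, ⟨4, 2, 2, 1⟩, ⟨4, 2, 0, -1⟩], 2, 1, ![(1, 0), (1, 0), (-1, 0)]⟩,
  ⟨![⟨1, 0, 0, 0⟩, ⟨3, 4, 2, 1⟩, ⟨3, 4, 1, -1⟩], 2, 1, ![(1, 0), (1, 0), (-1, 0)]⟩,
  ⟨![⟨1, 0, 0, 0⟩, ⟨4, 4, 2, 1⟩, ⟨4, 4, 1, -1⟩], 2, 1, ![(1, 0), (1, 0), (-1, 0)]⟩,
  ⟨![⟨1, 0, 0, 0⟩, ⟨2, 0, 0, 1⟩, ⟨3, 8, 5, -1⟩], 2, 2, ![(1, 0), (1, 0), (1, 0)]⟩,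
  ⟨![⟨1, 0, 0, 0⟩, ⟨2, 2, 2, 1⟩, ⟨3, 2, 0, -1⟩], 2, 1, ![(1, 0), (1, 0), (1, 1)]⟩,
  ⟨![⟨1, 0, 0, 0⟩, ⟨2, 4, 3, 1⟩, ⟨4, 8, 5, -1⟩], 2, 2, ![(1, 0), (1, 0), (1, 0)]⟩,
  ⟨![⟨1, 0, 0, 0⟩, ⟨2, 6, 5, 1⟩, ⟨4, 2, 0, -1⟩], 2, 1, ![(1, 0), (1, 0), (1, 1)]⟩,
  ⟨![⟨0, 0, 0, 0⟩, ⟨3, 2, 2, 1⟩, ⟨4, 8, 5, -1⟩], 3, 2, ![(1, 0), (1, 0), (1, 0)]⟩,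
  ⟨![⟨0, 0, 0, 0⟩, ⟨3, 5, 4, 1⟩, ⟨4, 5, 3, -1⟩], 1, 1, ![(1, 0), (1, 0), (1, 1)]⟩,
  ⟨![⟨0, 0, 0, 0⟩, ⟨2, 0, 0, 0⟩, ⟨3, 0, 0, 0⟩], 0, 1, ![(1, 0), (1, 0), (1, 0)]⟩,
  ⟨![⟨0, 0, 0, 0⟩, ⟨2, 6, 4, 0⟩, ⟨4, 2, 1, 0⟩], 0, 1, ![(1, 0), (1, 0), (1, 1)]⟩,
  ⟨![⟨1, 0, 0, 0⟩, ⟨3, 6, 3, 0⟩, ⟨4, 6, 3, 0⟩], 0, 1, ![(1, 0), (1, 0), (1, 0)]⟩]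

set_option maxRecDepth 100000 in
lemma check_fam6 : Check 8 6 fam6 := by decide +kernel

/-- Families for `n = 16 * j + 8`. -/
def fam8 : List Fam := [
  ⟨![⟨2, 0, 0, 0⟩, ⟨3, 0, 1, 1⟩, ⟨4, 16, 7, -1⟩], 8, 3, ![(1, 0), (1, 0), (1, 0)]⟩,
  ⟨![⟨0, 0, 0, 0⟩, ⟨2, 0, 1, 0⟩, ⟨3, 0, 1, 0⟩], 0, 1, ![(1, 0), (1, 0), (1, 0)]⟩,
  ⟨![⟨0, 0, 0, 0⟩, ⟨2, 0, 2, 0⟩, ⟨3, 0, 0, 0⟩], 0, 1, ![(1, 0), (1, 0), (1, 1)]⟩,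
  ⟨![⟨0, 0, 0, 0⟩, ⟨2, 0, 3, 1⟩, ⟨3, 16, 7, -1⟩], 4, 0, ![(1, 0), (1, 0), (1, 0)]⟩,
  ⟨![⟨0, 0, 0, 0⟩, ⟨3, 4, 4, 1⟩, ⟨3, 4, 3, -1⟩], 4, 2, ![(1, 0), (1, 0), (-1, 0)]⟩,
  ⟨![⟨1, 0, 0, 0⟩, ⟨3, 0, 1, 1⟩, ⟨3, 16, 7, -1⟩], 4, 1, ![(1, 0), (1, 0), (-1, 1)]⟩,
  ⟨![⟨1, 0, 0, 0⟩, ⟨2, 8, 5, 1⟩, ⟨3, 8, 4, -1⟩], 4, 2, ![(1, 0), (1, 0), (1, 1)]⟩,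
  ⟨![⟨1, 0, 0, 0⟩, ⟨2, 4, 2, 1⟩, ⟨4, 12, 6, -1⟩], 4, 2, ![(1, 0), (1, 0), (1, 0)]⟩,
  ⟨![⟨1, 0, 0, 0⟩, ⟨4, 4, 3, 1⟩, ⟨4, 4, 1, -1⟩], 4, 1, ![(1, 0), (1, 0), (-1, 0)]⟩,
  ⟨![⟨1, 0, 0, 0⟩, ⟨2, 0, 1, 1⟩, ⟨2, 16, 7, -1⟩], 4, 1, ![(1, 0), (1, 0), (-1, 1)]⟩,
  ⟨![⟨0, 0, 0, 0⟩, ⟨3, 8, 6, 1⟩, ⟨4, 8, 3, -1⟩], 4, 2, ![(1, 0), (1, 0), (1, 1)]⟩,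
  ⟨![⟨0, 0, 0, 0⟩, ⟨2, 12, 6, 1⟩, ⟨4, 4, 1, -1⟩], 2, 2, ![(1, 0), (1, 0), (1, 1)]⟩,
  ⟨![⟨1, 0, 0, 0⟩, ⟨3, 8, 6, 1⟩, ⟨4, 16, 7, -1⟩], 4, 1, ![(1, 0), (1, 0), (1, 0)]⟩,
  ⟨![⟨0, 0, 0, 0⟩, ⟨4, 14, 6, 1⟩, ⟨4, 14, 5, -1⟩], 2, 2, ![(1, 0), (1, 0), (-1, 0)]⟩,
  ⟨![⟨0, 0, 0, 0⟩, ⟨4, 0, 0, 1⟩, ⟨4, 12, 3, -1⟩], 2, 0, ![(1, 0), (1, 0), (-1, 1)]⟩,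
  ⟨![⟨0, 0, 0, 0⟩, ⟨2, 6, 4, 1⟩, ⟨4, 10, 3, -1⟩], 2, 0, ![(1, 0), (1, 0), (1, 0)]⟩,
  ⟨![⟨0, 0, 0, 0⟩, ⟨2, 10, 5, 1⟩, ⟨2, 10, 4, -1⟩], 2, 1, ![(1, 0), (1, 0), (-1, 0)]⟩,
  ⟨![⟨0, 0, 0, 0⟩, ⟨2, 4, 3, 0⟩, ⟨2, 0, 0, 0⟩], 0, 1, ![(1, 0), (1, 0), (-1, 0)]⟩,
  ⟨![⟨0, 0, 0, 0⟩, ⟨2, 4, 4, 1⟩, ⟨2, 16, 7, -1⟩], 2, 0, ![(1, 0), (1, 0), (-1, 1)]⟩,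
  ⟨![⟨1, 0, 0, 0⟩, ⟨2, 8, 4, 0⟩, ⟨3, 0, 0, 0⟩], 0, 1, ![(1, 0), (1, 0), (1, 1)]⟩,
  ⟨![⟨1, 0, 0, 0⟩, ⟨2, 0, 0, 0⟩, ⟨4, 0, 0, 0⟩], 0, 1, ![(1, 0), (1, 0), (1, 0)]⟩,
  ⟨![⟨1, 0, 0, 0⟩, ⟨3, 4, 2, 0⟩, ⟨4, 4, 2, 0⟩], 0, 1, ![(1, 0), (1, 0), (1, 0)]⟩,
  ⟨![⟨1, 0, 0, 0⟩, ⟨3, 8, 5, 0⟩, ⟨4, 8, 4, 0⟩], 0, 1, ![(1, 0), (1, 0), (1, 1)]⟩]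

set_option maxRecDepth 100000 in
lemma check_fam8 : Check 16 8 fam8 := by decide +kernel

/-- Families for `n = 16 * j + 32`. -/
def fam0 : List Fam := [
  ⟨![⟨2, 0, 0, 0⟩, ⟨3, 0, 1, 1⟩, ⟨4, 16, 31, -1⟩], 8, 15, ![(1, 0), (1, 0), (1, 0)]⟩,
  ⟨![⟨0, 0, 0, 0⟩, ⟨4, 0, 2, 1⟩, ⟨4, 16, 31, -1⟩], 4, 7, ![(1, 0), (1, 0), (-1, 1)]⟩,
  ⟨![⟨0, 0, 0, 0⟩, ⟨3, 4, 11, 1⟩, ⟨3, 4, 8, -1⟩], 4, 7, ![(1, 0), (1, 0), (-1, 0)]⟩,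
  ⟨![⟨1, 0, 0, 0⟩, ⟨3, 0, 2, 1⟩, ⟨4, 4, 7, -1⟩], 2, 3, ![(1, 0), (1, 0), (1, 0)]⟩,
  ⟨![⟨1, 0, 0, 0⟩, ⟨3, 2, 5, 1⟩, ⟨4, 2, 4, -1⟩], 2, 5, ![(1, 0), (1, 0), (1, 1)]⟩,
  ⟨![⟨1, 0, 0, 0⟩, ⟨3, 4, 10, 1⟩, ⟨4, 16, 31, -1⟩], 4, 6, ![(1, 0), (1, 0), (1, 0)]⟩,
  ⟨![⟨1, 0, 0, 0⟩, ⟨2, 8, 15, 1⟩, ⟨2, 8, 14, -1⟩], 4, 8, ![(1, 0), (1, 0), (-1, 0)]⟩,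
  ⟨![⟨1, 0, 0, 0⟩, ⟨2, 12, 23, 0⟩, ⟨3, 12, 23, 0⟩], 0, 1, ![(1, 0), (1, 0), (1, 0)]⟩,
  ⟨![⟨1, 0, 0, 0⟩, ⟨2, 12, 24, 1⟩, ⟨3, 12, 22, -1⟩], 4, 7, ![(1, 0), (1, 0), (1, 1)]⟩,
  ⟨![⟨1, 0, 0, 0⟩, ⟨4, 8, 19, 1⟩, ⟨4, 8, 17, -1⟩], 4, 7, ![(1, 0), (1, 0), (-1, 0)]⟩,
  ⟨![⟨0, 0, 0, 0⟩, ⟨2, 12, 27, 1⟩, ⟨2, 12, 23, -1⟩], 4, 5, ![(1, 0), (1, 0), (-1, 0)]⟩,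
  ⟨![⟨0, 0, 0, 0⟩, ⟨2, 0, 0, 0⟩, ⟨2, 8, 18, 0⟩], 0, 1, ![(1, 0), (1, 0), (-1, 1)]⟩,
  ⟨![⟨1, 0, 0, 0⟩, ⟨2, 16, 31, 0⟩, ⟨3, 16, 30, 0⟩], 0, 1, ![(1, 0), (1, 0), (1, 1)]⟩,
  ⟨![⟨1, 0, 0, 0⟩, ⟨2, 0, 0, 1⟩, ⟨3, 16, 29, -1⟩], 4, 6, ![(1, 0), (1, 0), (1, 0)]⟩,
  ⟨![⟨0, 0, 0, 0⟩, ⟨2, 0, 1, 1⟩, ⟨4, 8, 15, -1⟩], 2, 1, ![(1, 0), (1, 0), (1, 0)]⟩,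
  ⟨![⟨0, 0, 0, 0⟩, ⟨3, 12, 26, 1⟩, ⟨3, 12, 24, -1⟩], 4, 6, ![(1, 0), (1, 0), (-1, 0)]⟩,
  ⟨![⟨0, 0, 0, 0⟩, ⟨3, 0, 0, 0⟩, ⟨3, 8, 18, 0⟩], 0, 1, ![(1, 0), (1, 0), (-1, 1)]⟩,
  ⟨![⟨0, 0, 0, 0⟩, ⟨2, 4, 9, 1⟩, ⟨4, 12, 24, -1⟩], 2, 4, ![(1, 0), (1, 0), (1, 0)]⟩,
  ⟨![⟨0, 0, 0, 0⟩, ⟨2, 6, 14, 1⟩, ⟨4, 10, 20, -1⟩], 2, 4, ![(1, 0), (1, 0), (1, 0)]⟩,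
  ⟨![⟨0, 0, 0, 0⟩, ⟨2, 2, 5, 1⟩, ⟨4, 6, 12, -1⟩], 2, 3, ![(1, 0), (1, 0), (1, 0)]⟩,
  ⟨![⟨0, 0, 0, 0⟩, ⟨2, 2, 2, 0⟩, ⟨2, 2, 4, 0⟩], 0, 1, ![(1, 0), (1, 0), (1, 0)]⟩,
  ⟨![⟨0, 0, 0, 0⟩, ⟨2, 12, 24, 0⟩, ⟨3, 4, 9, 0⟩], 0, 1, ![(1, 0), (1, 0), (1, 1)]⟩,
  ⟨![⟨0, 0, 0, 0⟩, ⟨2, 12, 26, 0⟩, ⟨3, 4, 10, 0⟩], 0, 1, ![(1, 0), (1, 0), (1, 1)]⟩,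
  ⟨![⟨0, 0, 0, 0⟩, ⟨3, 12, 25, 0⟩, ⟨4, 0, 0, 0⟩], 0, 1, ![(1, 0), (1, 0), (1, 1)]⟩,
  ⟨![⟨0, 0, 0, 0⟩, ⟨3, 0, 1, 0⟩, ⟨4, 0, 1, 0⟩], 0, 1, ![(1, 0), (1, 0), (1, 0)]⟩,
  ⟨![⟨0, 0, 0, 0⟩, ⟨2, 12, 25, 0⟩, ⟨4, 4, 9, 0⟩], 0, 1, ![(1, 0), (1, 0), (1, 1)]⟩,
  ⟨![⟨0, 0, 0, 0⟩, ⟨2, 2, 3, 0⟩, ⟨4, 6, 13, 0⟩], 0, 1, ![(1, 0), (1, 0), (1, 0)]⟩,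
  ⟨![⟨0, 0, 0, 0⟩, ⟨2, 6, 13, 0⟩, ⟨4, 6, 14, 0⟩], 0, 1, ![(1, 0), (1, 0), (1, 0)]⟩,
  ⟨![⟨0, 0, 0, 0⟩, ⟨2, 4, 8, 0⟩, ⟨4, 8, 16, 0⟩], 0, 1, ![(1, 0), (1, 0), (1, 0)]⟩,
  ⟨![⟨1, 0, 0, 0⟩, ⟨3, 0, 0, 0⟩, ⟨3, 0, 1, 0⟩], 0, 1, ![(1, 0), (1, 0), (1, 0)]⟩,
  ⟨![⟨1, 0, 0, 0⟩, ⟨3, 16, 31, 0⟩, ⟨4, 4, 8, 0⟩], 0, 1, ![(1, 0), (1, 0), (1, 1)]⟩,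
  ⟨![⟨1, 0, 0, 0⟩, ⟨4, 4, 9, 0⟩, ⟨4, 4, 10, 0⟩], 0, 1, ![(1, 0), (1, 0), (1, 0)]⟩,
  ⟨![⟨1, 0, 0, 0⟩, ⟨2, 4, 6, 0⟩, ⟨4, 8, 18, 0⟩], 0, 1, ![(1, 0), (1, 0), (1, 0)]⟩]

set_option maxRecDepth 100000 in
lemma check_fam0 : Check 16 32 fam0 := by decide +kernel

/-- Families for `n = 0 * j + 16`. -/
def fam16 : List Fam := [
  ⟨![⟨2, 0, 0, 0⟩, ⟨3, 0, 1, 1⟩, ⟨4, 0, 15, -1⟩], 0, 7, ![(1, 0), (1, 0), (1, 0)]⟩,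
  ⟨![⟨0, 0, 0, 0⟩, ⟨2, 0, 2, 0⟩, ⟨2, 0, 7, 0⟩], 0, 1, ![(1, 0), (1, 0), (1, 0)]⟩,
  ⟨![⟨0, 0, 0, 0⟩, ⟨2, 0, 5, 0⟩, ⟨2, 0, 9, 0⟩], 0, 1, ![(1, 0), (1, 0), (1, 0)]⟩,
  ⟨![⟨0, 0, 0, 0⟩, ⟨2, 0, 3, 0⟩, ⟨3, 0, 1, 0⟩], 0, 1, ![(1, 0), (1, 0), (1, 1)]⟩,
  ⟨![⟨0, 0, 0, 0⟩, ⟨2, 0, 6, 0⟩, ⟨3, 0, 2, 0⟩], 0, 1, ![(1, 0), (1, 0), (1, 1)]⟩,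
  ⟨![⟨0, 0, 0, 0⟩, ⟨2, 0, 4, 0⟩, ⟨3, 0, 4, 0⟩], 0, 1, ![(1, 0), (1, 0), (1, 0)]⟩,
  ⟨![⟨0, 0, 0, 0⟩, ⟨2, 0, 11, 0⟩, ⟨3, 0, 5, 0⟩], 0, 1, ![(1, 0), (1, 0), (1, 1)]⟩,
  ⟨![⟨0, 0, 0, 0⟩, ⟨3, 0, 0, 0⟩, ⟨3, 0, 6, 0⟩], 0, 1, ![(1, 0), (1, 0), (1, 0)]⟩,
  ⟨![⟨0, 0, 0, 0⟩, ⟨3, 0, 7, 0⟩, ⟨3, 0, 8, 0⟩], 0, 1, ![(1, 0), (1, 0), (1, 0)]⟩,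
  ⟨![⟨0, 0, 0, 0⟩, ⟨2, 0, 12, 0⟩, ⟨3, 0, 9, 0⟩], 0, 1, ![(1, 0), (1, 0), (1, 1)]⟩,
  ⟨![⟨0, 0, 0, 0⟩, ⟨3, 0, 3, 0⟩, ⟨3, 0, 10, 0⟩], 0, 1, ![(1, 0), (1, 0), (1, 0)]⟩,
  ⟨![⟨0, 0, 0, 0⟩, ⟨2, 0, 14, 0⟩, ⟨4, 0, 1, 0⟩], 0, 1, ![(1, 0), (1, 0), (1, 1)]⟩,
  ⟨![⟨0, 0, 0, 0⟩, ⟨4, 0, 0, 0⟩, ⟨4, 0, 2, 0⟩], 0, 1, ![(1, 0), (1, 0), (1, 0)]⟩,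
  ⟨![⟨0, 0, 0, 0⟩, ⟨2, 0, 1, 0⟩, ⟨4, 0, 3, 0⟩], 0, 1, ![(1, 0), (1, 0), (1, 0)]⟩,
  ⟨![⟨0, 0, 0, 0⟩, ⟨2, 0, 0, 0⟩, ⟨4, 0, 4, 0⟩], 0, 1, ![(1, 0), (1, 0), (1, 0)]⟩,
  ⟨![⟨0, 0, 0, 0⟩, ⟨2, 0, 13, 0⟩, ⟨4, 0, 5, 0⟩], 0, 1, ![(1, 0), (1, 0), (1, 1)]⟩,
  ⟨![⟨0, 0, 0, 0⟩, ⟨2, 0, 15, 0⟩, ⟨4, 0, 6, 0⟩], 0, 1, ![(1, 0), (1, 0), (1, 1)]⟩,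
  ⟨![⟨0, 0, 0, 0⟩, ⟨3, 0, 12, 0⟩, ⟨4, 0, 7, 0⟩], 0, 1, ![(1, 0), (1, 0), (1, 1)]⟩,
  ⟨![⟨0, 0, 0, 0⟩, ⟨2, 0, 8, 0⟩, ⟨4, 0, 9, 0⟩], 0, 1, ![(1, 0), (1, 0), (1, 0)]⟩,
  ⟨![⟨0, 0, 0, 0⟩, ⟨2, 0, 10, 0⟩, ⟨4, 0, 10, 0⟩], 0, 1, ![(1, 0), (1, 0), (1, 0)]⟩,
  ⟨![⟨0, 0, 0, 0⟩, ⟨3, 0, 14, 0⟩, ⟨4, 0, 11, 0⟩], 0, 1, ![(1, 0), (1, 0), (1, 1)]⟩,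
  ⟨![⟨0, 0, 0, 0⟩, ⟨3, 0, 11, 0⟩, ⟨4, 0, 12, 0⟩], 0, 1, ![(1, 0), (1, 0), (1, 0)]⟩,
  ⟨![⟨0, 0, 0, 0⟩, ⟨3, 0, 13, 0⟩, ⟨4, 0, 13, 0⟩], 0, 1, ![(1, 0), (1, 0), (1, 0)]⟩,
  ⟨![⟨0, 0, 0, 0⟩, ⟨3, 0, 15, 0⟩, ⟨4, 0, 14, 0⟩], 0, 1, ![(1, 0), (1, 0), (1, 1)]⟩,
  ⟨![⟨0, 0, 0, 0⟩, ⟨4, 0, 8, 0⟩, ⟨4, 0, 15, 0⟩], 0, 1, ![(1, 0), (1, 0), (1, 0)]⟩,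
  ⟨![⟨1, 0, 0, 0⟩, ⟨2, 0, 2, 0⟩, ⟨2, 0, 5, 0⟩], 0, 1, ![(1, 0), (1, 0), (1, 0)]⟩,
  ⟨![⟨1, 0, 0, 0⟩, ⟨2, 0, 6, 0⟩, ⟨2, 0, 7, 0⟩], 0, 1, ![(1, 0), (1, 0), (1, 0)]⟩,
  ⟨![⟨1, 0, 0, 0⟩, ⟨2, 0, 3, 0⟩, ⟨2, 0, 9, 0⟩], 0, 1, ![(1, 0), (1, 0), (1, 0)]⟩,
  ⟨![⟨1, 0, 0, 0⟩, ⟨2, 0, 4, 0⟩, ⟨2, 0, 13, 0⟩], 0, 1, ![(1, 0), (1, 0), (-1, 1)]⟩,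
  ⟨![⟨1, 0, 0, 0⟩, ⟨2, 0, 0, 0⟩, ⟨2, 0, 14, 0⟩], 0, 1, ![(1, 0), (1, 0), (-1, 1)]⟩,
  ⟨![⟨1, 0, 0, 0⟩, ⟨2, 0, 8, 0⟩, ⟨3, 0, 1, 0⟩], 0, 1, ![(1, 0), (1, 0), (1, 1)]⟩,
  ⟨![⟨1, 0, 0, 0⟩, ⟨2, 0, 11, 0⟩, ⟨3, 0, 3, 0⟩], 0, 1, ![(1, 0), (1, 0), (1, 1)]⟩,
  ⟨![⟨1, 0, 0, 0⟩, ⟨3, 0, 0, 0⟩, ⟨3, 0, 5, 0⟩], 0, 1, ![(1, 0), (1, 0), (1, 0)]⟩,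
  ⟨![⟨1, 0, 0, 0⟩, ⟨3, 0, 2, 0⟩, ⟨3, 0, 6, 0⟩], 0, 1, ![(1, 0), (1, 0), (1, 0)]⟩,
  ⟨![⟨1, 0, 0, 0⟩, ⟨3, 0, 4, 0⟩, ⟨3, 0, 7, 0⟩], 0, 1, ![(1, 0), (1, 0), (1, 0)]⟩,
  ⟨![⟨1, 0, 0, 0⟩, ⟨3, 0, 8, 0⟩, ⟨3, 0, 10, 0⟩], 0, 1, ![(1, 0), (1, 0), (1, 0)]⟩,
  ⟨![⟨1, 0, 0, 0⟩, ⟨2, 0, 12, 0⟩, ⟨3, 0, 11, 0⟩], 0, 1, ![(1, 0), (1, 0), (1, 1)]⟩,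
  ⟨![⟨1, 0, 0, 0⟩, ⟨2, 0, 1, 0⟩, ⟨3, 0, 12, 0⟩], 0, 1, ![(1, 0), (1, 0), (1, 0)]⟩,
  ⟨![⟨1, 0, 0, 0⟩, ⟨2, 0, 10, 0⟩, ⟨4, 0, 0, 0⟩], 0, 1, ![(1, 0), (1, 0), (1, 1)]⟩,
  ⟨![⟨1, 0, 0, 0⟩, ⟨3, 0, 15, 0⟩, ⟨4, 0, 2, 0⟩], 0, 1, ![(1, 0), (1, 0), (1, 1)]⟩,
  ⟨![⟨1, 0, 0, 0⟩, ⟨2, 0, 15, 0⟩, ⟨4, 0, 4, 0⟩], 0, 1, ![(1, 0), (1, 0), (1, 1)]⟩,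
  ⟨![⟨1, 0, 0, 0⟩, ⟨3, 0, 14, 0⟩, ⟨4, 0, 5, 0⟩], 0, 1, ![(1, 0), (1, 0), (1, 1)]⟩,
  ⟨![⟨1, 0, 0, 0⟩, ⟨3, 0, 13, 0⟩, ⟨4, 0, 6, 0⟩], 0, 1, ![(1, 0), (1, 0), (1, 1)]⟩,
  ⟨![⟨1, 0, 0, 0⟩, ⟨4, 0, 1, 0⟩, ⟨4, 0, 7, 0⟩], 0, 1, ![(1, 0), (1, 0), (1, 0)]⟩,
  ⟨![⟨1, 0, 0, 0⟩, ⟨4, 0, 3, 0⟩, ⟨4, 0, 8, 0⟩], 0, 1, ![(1, 0), (1, 0), (1, 0)]⟩,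
  ⟨![⟨1, 0, 0, 0⟩, ⟨4, 0, 10, 0⟩, ⟨4, 0, 11, 0⟩], 0, 1, ![(1, 0), (1, 0), (1, 0)]⟩,
  ⟨![⟨1, 0, 0, 0⟩, ⟨4, 0, 9, 0⟩, ⟨4, 0, 13, 0⟩], 0, 1, ![(1, 0), (1, 0), (1, 0)]⟩,
  ⟨![⟨1, 0, 0, 0⟩, ⟨3, 0, 9, 0⟩, ⟨4, 0, 14, 0⟩], 0, 1, ![(1, 0), (1, 0), (1, 0)]⟩,
  ⟨![⟨1, 0, 0, 0⟩, ⟨4, 0, 12, 0⟩, ⟨4, 0, 15, 0⟩], 0, 1, ![(1, 0), (1, 0), (1, 0)]⟩]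

set_option maxRecDepth 100000 in
lemma check_fam16 : Check 0 16 fam16 := by decide +kernel

end OOC15

theorem stmt_15 (n : ℕ) (hn : 0 < n) (h : n % 8 = 0 ∨ n % 8 = 6) :
    ∃ (R : Finset (Fin 5)) (C : Finset (Finset (Fin 5 × ZMod n))),
      R.card = 2 ∧ IsOOC 5 n 3 1 C ∧ (∀ i ∈ R, ∀ j ∈ R, Delta i j C = 0) ∧
      C.card = (7 * n - 2) / 2 := by
  rcases h with h | h
  · by_cases h1 : n % 16 = 8
    · exact OOC15.check_fam8.main (n / 16) n (by omega)
    · by_cases h2 : n = 16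
      · exact OOC15.check_fam16.main 0 n (by omega)
      · exact OOC15.check_fam0.main ((n - 32) / 16) n (by omega)
  · exact OOC15.check_fam6.main (n / 8) n (by omega)
end
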